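/- arXiv:2405.06825 — 3 statements merged into one kernel-verified Lean document; each statement's English description precedes it below -/
import Mathlib

section
/- Let K be a number field. For any integers n > 2 and r ≥ 1 with r dividing n, there exists an irreducible polynomial f over K of degree n whose cluster size over K equals r, i.e., for any root α of f in a fixed algebraic closure of K, exactly r of the roots of f lie in K(α). -/
open scoped Pointwise NumberField

theorem transfer_apply_of_normal {G A : Type*} [Group G] [CommGroup A] {V : Subgroup G} [hV : V.Normal]
    [V.FiniteIndex] [Fintype (G ⧸ V)] (χ : V →* A) (v : V) :
    χ.transfer (v : G) =
      ∏ q : G ⧸ V, χ ⟨(q.out)⁻¹ * v * q.out, by simpa using hV.conj_mem v v.2 q.out⁻¹⟩ := by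
  classical
  have hT : Subgroup.IsComplement (Set.range (Quotient.out : G ⧸ V → G)) (V : Set G) :=
    Subgroup.isComplement_range_left (fun q => by simp)
  let T : V.LeftTransversal := ⟨_, hT⟩
  have hTq : ∀ q, (T.2.leftQuotientEquiv q : G) = q.out := fun q =>
    Subgroup.IsComplement.leftQuotientEquiv_apply (fun q => by simp) q
  have hq : ∀ q : G ⧸ V, (v : G)⁻¹ • q = q := by
    intro q
    induction q using QuotientGroup.induction_on with
    | H g =>
      rw [MulAction.Quotient.smul_coe, eq_comm, QuotientGroup.eq]
      have := hV.conj_mem _ (V.inv_mem v.2) g⁻¹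
      simpa [mul_assoc] using this
  rw [MonoidHom.transfer_def χ T, Subgroup.leftTransversals.diff]
  refine Finset.prod_congr (by ext; simp) fun q _ => ?_
  congr 2
  rw [Subgroup.smul_apply_eq_smul_apply_inv_smul, hq, hTq, smul_eq_mul, mul_assoc]

theorem exists_subgroup_normalizer_eq {G A : Type*} [Group G] [Finite G] [CommGroup A]
    (V N₀ : Subgroup G) [hV : V.Normal] (hle : V ≤ N₀) (χ : V →* A) (v : V)
    (hv : ∀ (g : G), g ∉ V → χ ⟨g⁻¹ * v * g, by simpa using hV.conj_mem v v.2 g⁻¹⟩ = 1)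
    (hgen : ∀ a : A, a ∈ Subgroup.zpowers (χ v)) (h1 : χ v ≠ 1) :
    ∃ H : Subgroup G, H ≤ N₀ ∧ H.relIndex N₀ = Nat.card A ∧
      Subgroup.normalizer (H : Set G) = N₀ := by
  classical
  let W : Subgroup N₀ := V.subgroupOf N₀
  let e : W →* V := (Subgroup.subgroupOfEquivOfLe hle).toMonoidHom
  let φ : N₀ →* A := (χ.comp e).transfer
  let _ : Fintype (N₀ ⧸ W) := Fintype.ofFinite _
  have hφ : ∀ w : W, φ w = ∏ q : N₀ ⧸ W, χ ⟨((q.out : N₀) : G)⁻¹ * (w : N₀) * (q.out : N₀),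
      by simpa using hV.conj_mem _ w.2 ((q.out : N₀) : G)⁻¹⟩ := by
    intro w
    rw [transfer_apply_of_normal]
    rfl
  have hφv : φ ⟨v, hle v.2⟩ = χ v := by
    refine (hφ ⟨⟨v, hle v.2⟩, v.2⟩).trans ?_
    rw [Finset.prod_eq_single ((1 : N₀) : N₀ ⧸ W)]
    · have hm : ((((1 : N₀) : N₀ ⧸ W).out : N₀) : G) ∈ V := by
        have : (((1 : N₀) : N₀ ⧸ W).out : N₀) ∈ W := by
          rw [← QuotientGroup.eq_one_iff]; simp
        exact this
      set t := ((((1 : N₀) : N₀ ⧸ W).out : N₀) : G)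
      have : (⟨t⁻¹ * v * t, by simpa using hV.conj_mem v v.2 t⁻¹⟩ : V)
        = (⟨t, hm⟩ : V)⁻¹ * v * ⟨t, hm⟩ := rfl
      rw [this, map_mul, map_mul, map_inv]
      simp [mul_comm]
    · intro q _ hq
      apply hv
      intro hm
      apply hq
      have : (q.out : N₀) ∈ W := hm
      rw [← QuotientGroup.eq_one_iff] at this
      simpa using this
    · simp
  have hφg : ∀ (g : G) (_ : g ∉ N₀) (hm : g⁻¹ * v * g ∈ V), φ ⟨g⁻¹ * v * g, hle hm⟩ = 1 := by
    intro g hg hm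
    refine (hφ ⟨⟨_, hle hm⟩, hm⟩).trans ?_
    refine Finset.prod_eq_one fun q _ => ?_
    have := hv (g * (q.out : N₀)) (fun h => hg ?_)
    · rw [← this]
      congr 2
      simp [mul_assoc]
    · simpa using N₀.mul_mem (hle h) (N₀.inv_mem (q.out : N₀).2)
  have hsurj : Function.Surjective φ := by
    intro a
    obtain ⟨k, hk⟩ := hgen a
    exact ⟨⟨v, hle v.2⟩ ^ k, by rw [map_zpow, hφv]; exact hk⟩
  have hmem : ∀ (g : G) (hg : g ∈ N₀), g ∈ φ.ker.map N₀.subtype ↔ φ ⟨g, hg⟩ = 1 := by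
    intro g hg
    simp [Subgroup.mem_map, MonoidHom.mem_ker, hg]
  have hHle : φ.ker.map N₀.subtype ≤ N₀ := Subgroup.map_subtype_le _
  refine ⟨φ.ker.map N₀.subtype, hHle, ?_, le_antisymm ?_ ?_⟩
  · rw [Subgroup.relIndex, Subgroup.subgroupOf, Subgroup.comap_map_eq_self_of_injective
      N₀.subtype_injective, Subgroup.index_ker, MonoidHom.range_eq_top.2 hsurj]
    exact Nat.card_congr Subgroup.topEquiv.toEquiv
  · intro g hg
    by_contra hgN
    have hm : g⁻¹ * v * g ∈ V := by simpa using hV.conj_mem v v.2 g⁻¹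
    rw [Subgroup.mem_normalizer_iff] at hg
    have h2 := (hg (g⁻¹ * v * g)).1 ((hmem _ (hle hm)).2 (hφg g hgN hm))
    rw [show g * (g⁻¹ * v * g) * g⁻¹ = v by group] at h2
    rw [hmem _ (hle v.2), hφv] at h2
    exact h1 h2
  · intro g hg
    rw [Subgroup.mem_normalizer_iff]
    intro h
    by_cases hh : h ∈ N₀
    · have hc : g * h * g⁻¹ ∈ N₀ := N₀.mul_mem (N₀.mul_mem hg hh) (N₀.inv_mem hg)
      rw [hmem _ hh, hmem _ hc]
      have : (⟨g * h * g⁻¹, hc⟩ : N₀) = ⟨g, hg⟩ * ⟨h, hh⟩ * ⟨g, hg⟩⁻¹ := rfl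
      rw [this, map_mul, map_mul, map_inv, mul_comm (φ _) (φ _), mul_inv_cancel_right]
    · refine ⟨fun H => absurd (hHle H) hh, fun H => absurd ?_ hh⟩
      have := N₀.mul_mem (N₀.mul_mem (N₀.inv_mem hg) (hHle H)) hg
      simpa [mul_assoc] using this

open IntermediateField in
theorem card_algEquiv_fixedField {K M : Type*} [Field K] [Field M] [Algebra K M]
    [FiniteDimensional K M] [IsGalois K M] (H : Subgroup (M ≃ₐ[K] M)) :
    Nat.card (fixedField H ≃ₐ[K] fixedField H) =
      H.relIndex (Subgroup.normalizer (H : Set (M ≃ₐ[K] M))) := by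
  have hmem : ∀ g : M ≃ₐ[K] M, g ∈ H ↔ ∀ x ∈ fixedField H, g x = x := by
    intro g
    conv_lhs => rw [← fixingSubgroup_fixedField H]
    rw [IntermediateField.mem_fixingSubgroup_iff]
  have key : ∀ g ∈ Subgroup.normalizer (H : Set (M ≃ₐ[K] M)), ∀ x ∈ fixedField H,
      g x ∈ fixedField H := by
    intro g hg x hx
    rw [mem_fixedField_iff] at hx ⊢
    intro h hh
    rw [Subgroup.mem_normalizer_iff''] at hg
    have := hx _ ((hg h).1 hh)
    simp only [AlgEquiv.mul_apply] at this
    apply_fun g at this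
    simpa [← AlgEquiv.mul_apply] using this
  let f : Subgroup.normalizer (H : Set (M ≃ₐ[K] M)) →* (fixedField H ≃ₐ[K] fixedField H) :=
    MonoidHom.mk' (fun g => AlgEquiv.ofAlgHom
      (((g : M ≃ₐ[K] M).toAlgHom.comp (fixedField H).val).codRestrict (fixedField H).toSubalgebra
        (fun x => key g g.2 x x.2))
      ((((g⁻¹ : Subgroup.normalizer (H : Set (M ≃ₐ[K] M))) : M ≃ₐ[K] M).toAlgHom.comp
        (fixedField H).val).codRestrict (fixedField H).toSubalgebra
        (fun x => key _ (g⁻¹).2 x x.2))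
      (by ext x; exact AlgEquiv.apply_symm_apply g.1 x.1)
      (by ext x; exact AlgEquiv.symm_apply_apply g.1 x.1))
      (fun a b => by ext x; rfl)
  have hf : ∀ g x, ((f g x : fixedField H) : M) = (g : M ≃ₐ[K] M) x := fun g x => rfl
  have hsurj : Function.Surjective f := by
    intro σ
    let g : M ≃ₐ[K] M := σ.liftNormal M
    have hg : ∀ x : fixedField H, g x = σ x := fun x => σ.liftNormal_commutes M x
    have hg' : ∀ x : fixedField H, g⁻¹ x = σ.symm x := fun x => by
      have := hg (σ.symm x)
      rw [AlgEquiv.apply_symm_apply] at this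
      rw [← this]
      exact AlgEquiv.symm_apply_apply g _
    refine ⟨⟨g, ?_⟩, ?_⟩
    · rw [Subgroup.mem_normalizer_iff]
      intro h
      rw [hmem, hmem]
      constructor
      · intro hh x hx
        rw [AlgEquiv.mul_apply, AlgEquiv.mul_apply, hg' ⟨x, hx⟩, hh _ (σ.symm ⟨x, hx⟩).2, hg]
        simp
      · intro hh x hx
        have := hh _ (σ ⟨x, hx⟩).2
        rw [AlgEquiv.mul_apply, AlgEquiv.mul_apply, hg', AlgEquiv.symm_apply_apply,
          ← hg ⟨x, hx⟩] at this
        exact g.injective this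
    · ext x
      rw [hf]
      exact hg x
  have hker : f.ker = H.subgroupOf _ := by
    ext g
    rw [MonoidHom.mem_ker, Subgroup.mem_subgroupOf]
    rw [hmem]
    constructor
    · intro h x hx
      rw [← hf g ⟨x, hx⟩, h]; rfl
    · intro h
      ext x
      rw [hf]
      exact h x x.2
  rw [Subgroup.relIndex, ← hker, Subgroup.index_ker, MonoidHom.range_eq_top.2 hsurj]
  exact (Nat.card_congr Subgroup.topEquiv.toEquiv).symm

open IntermediateField in
theorem exists_irreducible_of_card_algEquiv {K L : Type*} [Field K] [CharZero K] [Field L]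
    [Algebra K L] [FiniteDimensional K L] {n r : ℕ} (hn : Module.finrank K L = n)
    (hr : Nat.card (L ≃ₐ[K] L) = r) :
    ∃ f : Polynomial K, Irreducible f ∧ f.natDegree = n ∧
      ∀ α : AlgebraicClosure K, Polynomial.aeval α f = 0 →
        {x ∈ f.rootSet (AlgebraicClosure K) |
          x ∈ IntermediateField.adjoin K {α}}.ncard = r := by
  obtain ⟨a, ha⟩ := Field.exists_primitive_element K L
  have hai : IsIntegral K a := Algebra.IsIntegral.isIntegral a
  have hirr := minpoly.irreducible hai
  refine ⟨minpoly K a, hirr, ?_, ?_⟩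
  · rw [← hn, ← adjoin.finrank hai, ha, finrank_top']
  · intro α hα
    have hαi : IsIntegral K α := Algebra.IsIntegral.isIntegral α
    have hmin : minpoly K a = minpoly K α :=
      minpoly.eq_of_irreducible_of_monic hirr hα (minpoly.monic hai)
    let e : K⟮a⟯ ≃ₐ[K] K⟮α⟯ :=
      (adjoinRootEquivAdjoin K hai).symm.trans
        ((AdjoinRoot.algEquivOfEq K _ _ hmin).trans (adjoinRootEquivAdjoin K hαi))
    let e' : L ≃ₐ[K] K⟮α⟯ := (topEquiv.symm.trans (equivOfEq ha.symm)).trans e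
    have : FiniteDimensional K K⟮α⟯ := adjoin.finiteDimensional hαi
    rw [← hr, Nat.card_congr e'.autCongr.toEquiv,
      Nat.card_congr (algEquivEquivAlgHom K K⟮α⟯).toEquiv,
      Nat.card_congr (algHomAdjoinIntegralEquiv K hαi), ← hmin, ← Nat.card_coe_set_eq]
    refine Nat.card_congr
      { toFun := fun x => ⟨⟨x.1, x.2.2⟩, ?_⟩
        invFun := fun y => ⟨y.1, ?_, y.1.2⟩
        left_inv := fun x => rfl
        right_inv := fun y => rfl }
    · obtain ⟨x, hx, hxα⟩ := x
      rw [Polynomial.mem_aroots]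
      refine ⟨hirr.ne_zero, Subtype.ext ?_⟩
      exact (Polynomial.aeval_algebraMap_apply _ (⟨x, hxα⟩ : K⟮α⟯) _).symm.trans
        (Polynomial.mem_rootSet.1 hx).2
    · obtain ⟨y, hy⟩ := y
      rw [Polynomial.mem_rootSet]
      refine ⟨hirr.ne_zero, ?_⟩
      refine (Polynomial.aeval_algebraMap_apply _ y _).trans ?_
      rw [(Polynomial.mem_aroots.1 hy).2, map_zero]

theorem AlgEquiv.eq_one_of_adjoin_eq_top {K N : Type*} [Field K] [Field N] [Algebra K N] {S : Set N}
    (hS : IntermediateField.adjoin K S = ⊤) {σ : N ≃ₐ[K] N} (hσ : ∀ x ∈ S, σ x = x) : σ = 1 := by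
  ext x
  have hx : x ∈ IntermediateField.adjoin K S := hS ▸ IntermediateField.mem_top
  induction hx using IntermediateField.adjoin_induction with
  | mem x hx => exact hσ x hx
  | algebraMap x => exact σ.commutes x
  | add x y _ _ hx hy => rw [map_add, map_add, hx, hy]
  | inv x _ hx => rw [map_inv₀, map_inv₀, hx]
  | mul x y _ _ hx hy => rw [map_mul, map_mul, hx, hy]

theorem NumberField.exists_natCast_mul_sub_one_not_isUnit {N : Type*} [Field N] [NumberField N]
    {x : 𝓞 N} (hx : x ≠ 0) : ∃ k : ℕ, ¬ IsUnit ((k : 𝓞 N) * x - 1) := by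
  have hpos : ∀ w : InfinitePlace N, 0 < w (x : N) := fun w => by
    rw [InfinitePlace.pos_iff]; simpa using hx
  have hw : ∀ w : InfinitePlace N, ∀ᶠ k : ℕ in Filter.atTop, 2 < (k : ℝ) * w (x : N) := fun w =>
    (tendsto_natCast_atTop_atTop.atTop_mul_const (hpos w)).eventually_gt_atTop 2
  obtain ⟨k, hk⟩ := (Filter.eventually_all.2 hw).exists
  refine ⟨k, fun hu => ?_⟩
  rw [NumberField.isUnit_iff_norm] at hu
  have h1 := InfinitePlace.prod_eq_abs_norm ((((k : 𝓞 N) * x - 1 : 𝓞 N)) : N)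
  rw [← RingOfIntegers.coe_norm, hu] at h1
  have h2 : ∀ w : InfinitePlace N, 1 < w ((((k : 𝓞 N) * x - 1 : 𝓞 N)) : N) := fun w => by
    have h3 : w ((k : N) * x) ≤ w ((k : N) * x - 1) + w 1 := by
      have := w.1.add_le ((k : N) * x - 1) 1
      rwa [sub_add_cancel] at this
    have h4 : w ((k : N) * x) = k * w (x : N) := by
      rw [map_mul]
      congr 1
      rw [← InfinitePlace.norm_embedding_eq w]
      simp
    have := hk w
    rw [map_one] at h3
    push_cast
    linarith
  have h5 : (1 : ℝ) < ∏ w : InfinitePlace N, w ((((k : 𝓞 N) * x - 1 : 𝓞 N)) : N) ^ w.mult := by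
    simpa using Finset.prod_lt_prod_of_nonempty (f := fun _ : InfinitePlace N => (1 : ℝ))
      (fun _ _ => one_pos) (fun w _ => one_lt_pow₀ (h2 w) w.mult_pos.ne') Finset.univ_nonempty
  rw [h1] at h5
  norm_num at h5

theorem NumberField.exists_ne_zero_forall_smul_ne (K N : Type*) [Field K] [Field N] [NumberField N]
    [NumberField K] [Algebra K N] :
    ∃ γ : 𝓞 N, γ ≠ 0 ∧ ∀ σ : N ≃ₐ[K] N, σ • γ = γ → σ = 1 := by
  obtain ⟨a, ha⟩ := Field.exists_primitive_element K N
  have key : ∀ σ : N ≃ₐ[K] N, σ a = a → σ = 1 := fun σ h => by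
    exact AlgEquiv.eq_one_of_adjoin_eq_top ha (by simpa using h)
  by_cases h0 : a = 0
  · refine ⟨1, one_ne_zero, fun σ _ => key σ ?_⟩
    rw [h0, map_zero]
  · obtain ⟨m, hm⟩ := exists_integral_multiples ℤ ℚ ({a} : Finset N)
    have hm' := hm.2 a (by simp)
    refine ⟨⟨m • a, hm'⟩, ?_, fun σ hσ => key σ ?_⟩
    · intro h
      have h2 : m • a = 0 := congrArg (algebraMap (𝓞 N) N) h
      simp [h0, hm.1] at h2
    · have h2 : σ (m • a) = m • a := congrArg (algebraMap (𝓞 N) N) hσ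
      rw [map_zsmul] at h2
      exact smul_right_injective N hm.1 h2

theorem NumberField.exists_smul_maximalIdeal_ne (K N : Type*) [Field K] [Field N] [NumberField N]
    [NumberField K] [Algebra K N] {r : ℕ} (hr : r ≠ 0) :
    ∃ q : Ideal (𝓞 N), q.IsMaximal ∧ q ≠ ⊥ ∧ (r : 𝓞 N) ∉ q ∧
      ∀ σ : N ≃ₐ[K] N, σ • q = q → σ = 1 := by
  classical
  obtain ⟨γ, hγ0, hγ⟩ := NumberField.exists_ne_zero_forall_smul_ne K N
  let D : 𝓞 N := r * ∏ σ ∈ (Finset.univ : Finset (N ≃ₐ[K] N)).erase 1, (γ - σ • γ)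
  have hD0 : D ≠ 0 := by
    refine mul_ne_zero (by exact_mod_cast hr) (Finset.prod_ne_zero_iff.2 fun σ hσ h => ?_)
    exact (Finset.mem_erase.1 hσ).1 (hγ σ (sub_eq_zero.1 h).symm)
  let ND : 𝓞 N := ∏ σ : N ≃ₐ[K] N, σ • D
  let γ' : 𝓞 N := ∏ σ ∈ (Finset.univ : Finset (N ≃ₐ[K] N)).erase 1, σ • γ
  have hne : ∀ (σ : N ≃ₐ[K] N) {y : 𝓞 N}, y ≠ 0 → σ • y ≠ 0 := fun σ y hy h =>
    hy (by simpa using congrArg (σ⁻¹ • ·) h)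
  have hinv : ∀ (τ : N ≃ₐ[K] N) (y : 𝓞 N), τ • (∏ σ : N ≃ₐ[K] N, σ • y) = ∏ σ : N ≃ₐ[K] N, σ • y :=
    fun τ y => by
      rw [Finset.smul_prod']
      exact Fintype.prod_equiv (Equiv.mulLeft τ) _ _ fun σ => by simp [mul_smul]
  have hγγ' : γ * γ' = ∏ σ : N ≃ₐ[K] N, σ • γ := by
    rw [← Finset.mul_prod_erase _ _ (Finset.mem_univ 1), one_smul]
  have hDND : D ∣ ND := by
    have := Finset.dvd_prod_of_mem (fun σ : N ≃ₐ[K] N => σ • D) (Finset.mem_univ 1)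
    simpa using this
  have hx : γ' * ND ≠ 0 := mul_ne_zero (Finset.prod_ne_zero_iff.2 fun σ _ => hne σ hγ0)
    (Finset.prod_ne_zero_iff.2 fun σ _ => hne σ hD0)
  obtain ⟨k, hk⟩ := NumberField.exists_natCast_mul_sub_one_not_isUnit hx
  obtain ⟨q, hq, hkq⟩ := exists_max_ideal_of_mem_nonunits hk
  have hDq : D ∉ q := fun h => by
    have h1 : (k : 𝓞 N) * (γ' * ND) ∈ q := 
      q.mul_mem_left _ (q.mul_mem_left _ (q.mem_of_dvd hDND h))
    have h2 : (1 : 𝓞 N) ∈ q := by simpa using q.sub_mem h1 hkq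
    exact hq.ne_top ((Ideal.eq_top_iff_one q).2 h2)
  refine ⟨q, hq, Ring.ne_bot_of_isMaximal_of_not_isField hq (RingOfIntegers.not_isField N),
    fun h => hDq (q.mul_mem_right _ h), fun σ hσ => ?_⟩
  let a : 𝓞 N := k * (∏ σ : N ≃ₐ[K] N, σ • γ) * ND
  have haσ : σ • a = a := by
    simp only [a, ND, smul_mul', hinv]
    congr 2
    exact map_natCast (MulSemiringAction.toRingHom _ (𝓞 N) σ) k
  have haq : a - γ ∈ q := by
    have : a - γ = γ * (k * (γ' * ND) - 1) := by simp only [a, ← hγγ']; ring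
    rw [this]
    exact q.mul_mem_left _ hkq
  have haq' : a - σ • γ ∈ q := by
    have := Ideal.smul_mem_pointwise_smul σ _ _ haq
    rwa [hσ, smul_sub, haσ] at this
  by_contra hσ1
  refine hDq (q.mul_mem_left _ (q.mem_of_dvd (Finset.dvd_prod_of_mem _ 
    (Finset.mem_erase.2 ⟨hσ1, Finset.mem_univ σ⟩)) ?_))
  simpa using q.sub_mem haq' haq

theorem NumberField.exists_mem_maximalIdeal_forall_smul_notMem (K N : Type*) [Field K] [Field N]
    [NumberField N] [NumberField K] [Algebra K N] {r : ℕ} (hr : r ≠ 0) :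
    ∃ (q : Ideal (𝓞 N)) (θ : 𝓞 N), q.IsMaximal ∧ q ≠ ⊥ ∧ (r : 𝓞 N) ∉ q ∧ θ ∈ q ∧ θ ∉ q ^ 2 ∧
      ∀ σ : N ≃ₐ[K] N, σ ≠ 1 → σ • θ ∉ q := by
  classical
  obtain ⟨q, hq, hq0, hrq, hσ⟩ := NumberField.exists_smul_maximalIdeal_ne K N hr
  obtain ⟨t, htq, htq2⟩ : ∃ t ∈ q, t ∉ q ^ 2 := by
    simpa using Ideal.exists_mem_pow_notMem_pow_succ q hq0 hq.ne_top 1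
  obtain ⟨θ, hθ⟩ := IsDedekindDomain.exists_forall_sub_mem_ideal (s := Finset.univ)
    (fun σ : N ≃ₐ[K] N => σ⁻¹ • q) (fun _ => 2)
    (fun σ _ => by
      refine Ideal.prime_of_isPrime ?_ inferInstance
      intro h
      apply hq0
      simpa using congrArg (σ • ·) h)
    (fun σ _ τ _ hne h => hne (by
      have h1 : (σ * τ⁻¹) • q = q := by
        rw [mul_smul, ← h, smul_inv_smul]
      exact mul_inv_eq_one.1 (hσ _ h1)))
    (fun σ => if (σ : N ≃ₐ[K] N) = 1 then t else 1)
  have h1 : θ - t ∈ q ^ 2 := by simpa using hθ 1 (Finset.mem_univ _)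
  refine ⟨q, θ, hq, hq0, hrq, ?_, ?_, fun σ hσ1 hmem => ?_⟩
  · simpa using q.add_mem (Ideal.pow_le_self two_ne_zero h1) htq
  · intro h
    exact htq2 (by simpa using (q ^ 2).sub_mem h h1)
  · have h2 := Ideal.pow_le_self two_ne_zero (hθ σ (Finset.mem_univ _))
    rw [if_neg hσ1, Ideal.mem_inv_pointwise_smul_iff, smul_sub, smul_one] at h2
    refine hq.ne_top ((Ideal.eq_top_iff_one q).2 ?_)
    simpa using q.sub_mem hmem h2

theorem NumberField.le_ramificationIdx_of_mem_pow {N M : Type*} [Field N] [Field M] [NumberField N]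
    [NumberField M] [Algebra N M] {p : Ideal (𝓞 N)} [hp : p.IsPrime] (hp0 : p ≠ ⊥)
    (P : Ideal (𝓞 M)) [hP : P.IsPrime] [P.LiesOver p] {θ : 𝓞 N} (hθ : θ ∉ p ^ 2)
    {r : ℕ} (hr : algebraMap (𝓞 N) (𝓞 M) θ ∈ P ^ r) : r ≤ P.ramificationIdx (𝓞 N) := by
  have hP0 : P ≠ ⊥ := Ideal.ne_bot_of_liesOver_of_ne_bot hp0 P
  have hθ0 : θ ≠ 0 := by rintro rfl; exact hθ (zero_mem _)
  rw [← Ideal.ramificationIdx'_eq_ramificationIdx p P hp0]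
  have h1 := Ideal.IsDedekindDomain.emultiplicity_map_eq_ramificationIdx'_mul (S := 𝓞 M)
    (v := p) (w := P) (I := Ideal.span {θ}) (by simpa using hθ0)
    (Ideal.prime_of_isPrime hp0 hp).irreducible (Ideal.prime_of_isPrime hP0 hP).irreducible hP0
  have h2 : (r : ℕ∞) ≤ emultiplicity P (Ideal.map (algebraMap (𝓞 N) (𝓞 M)) (Ideal.span {θ})) := by
    rw [← pow_dvd_iff_le_emultiplicity, Ideal.dvd_iff_le, Ideal.map_span, Set.image_singleton,
      Ideal.span_singleton_le_iff_mem]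
    exact hr
  have h3 : emultiplicity p (Ideal.span {θ}) ≤ 1 := by
    rw [← ENat.lt_add_one_iff (by simp), one_add_one_eq_two]
    refine emultiplicity_lt_iff_not_dvd.2 ?_
    rwa [Ideal.dvd_iff_le, Ideal.span_singleton_le_iff_mem]
  rw [h1] at h2
  have h4 := h2.trans (mul_le_mul_right h3 _)
  rw [mul_one] at h4
  exact_mod_cast h4

theorem NumberField.exists_algEquiv_apply_eq_mul {N M : Type*} [Field N] [Field M] [NumberField N]
    [NumberField M] [Algebra N M] [IsGalois N M] {q : Ideal (𝓞 N)} [hq : q.IsMaximal] (hq0 : q ≠ ⊥)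
    {θ : 𝓞 N} (hθ : θ ∈ q) (hθ2 : θ ∉ q ^ 2) {r : ℕ} (hr : r ≠ 0) (hrq : (r : 𝓞 N) ∉ q)
    {u : 𝓞 M} (hu : u ^ r = algebraMap (𝓞 N) (𝓞 M) θ) {ζ : M} (hζ : IsPrimitiveRoot ζ r)
    (hinj : ∀ v : M ≃ₐ[N] M, v u = u →
      (∀ (t : 𝓞 M) (s : 𝓞 N), s ∉ q → t ^ r = algebraMap (𝓞 N) (𝓞 M) s → v t = t) → v = 1) :
    ∃ v : M ≃ₐ[N] M, v u = ζ * u ∧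
      ∀ (t : 𝓞 M) (s : 𝓞 N), s ∉ q → t ^ r = algebraMap (𝓞 N) (𝓞 M) s → v t = t := by
  classical
  have : NeZero r := ⟨hr⟩
  obtain ⟨Q, hQ, hQq⟩ := Ideal.exists_maximal_ideal_liesOver_of_isIntegral (S := 𝓞 M) q
  let I := Q.inertia (M ≃ₐ[N] M)
  have hcard : r ≤ Nat.card I := by
    rw [Ideal.card_inertia_eq_ramificationIdxIn q Q,
      Ideal.ramificationIdxIn_eq_ramificationIdx q Q (M ≃ₐ[N] M)]
    refine NumberField.le_ramificationIdx_of_mem_pow hq0 Q hθ2 (r := r) ?_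
    rw [← hu]
    refine Ideal.pow_mem_pow (hQ.isPrime.mem_of_pow_mem r ?_) r
    rw [hu]
    exact (Ideal.mem_of_liesOver Q q θ).1 hθ
  have hrQ : (r : 𝓞 M) ∉ Q := fun h => hrq <| (Ideal.mem_of_liesOver Q q _).2 (by simpa using h)
  have hfix : ∀ v ∈ I, ∀ (t : 𝓞 M) (s : 𝓞 N), s ∉ q → t ^ r = algebraMap (𝓞 N) (𝓞 M) s →
      v t = t := by
    intro v hv t s hs ht
    have hvt : (v • t) ^ r = t ^ r := by rw [← smul_pow', ht, smul_algebraMap]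
    have htQ : t ∉ Q := fun h => hs <| (Ideal.mem_of_liesOver Q q s).2 <| by
      rw [← ht]
      exact Ideal.pow_mem_of_mem Q h r (Nat.pos_of_ne_zero hr)
    by_contra hne
    have hne' : v • t - t ≠ 0 := fun h => hne (congrArg (algebraMap (𝓞 M) M) (sub_eq_zero.1 h))
    have h1 := geom_sum₂_mul (v • t) t r
    rw [hvt, sub_self, mul_eq_zero, or_iff_left hne'] at h1
    have h2 := congrArg (Ideal.Quotient.mk Q) h1
    have h3 : Ideal.Quotient.mk Q (v • t) = Ideal.Quotient.mk Q t :=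
      Ideal.Quotient.eq.2 (AddSubgroup.mem_inertia.1 hv t)
    simp only [map_sum, map_mul, map_pow, h3, geom_sum₂_self, map_zero] at h2
    rw [← map_natCast (Ideal.Quotient.mk Q), ← map_pow, ← map_mul, Ideal.Quotient.eq_zero_iff_mem]
      at h2
    rcases hQ.isPrime.mem_or_mem h2 with h | h
    · exact hrQ h
    · exact htQ (hQ.isPrime.mem_of_pow_mem _ h)
  have hθ0 : θ ≠ 0 := by rintro rfl; exact hθ2 (zero_mem _)
  have hur : (u : M) ^ r = algebraMap N M θ := congrArg (algebraMap (𝓞 M) M) hu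
  have hu0 : (u : M) ≠ 0 := fun h => by
    rw [h, zero_pow hr] at hur
    exact hθ0 (by simpa using hur.symm)
  have hpow : ∀ v : M ≃ₐ[N] M, (v u / u) ^ r = 1 := fun v => by
    rw [div_pow, ← map_pow, hur, AlgEquiv.commutes, div_self]
    rw [← hur]
    exact pow_ne_zero r hu0
  let f : I → rootsOfUnity r M := fun v => rootsOfUnity.mkOfPowEq _ (hpow v)
  have hf : ∀ v, ((f v : Mˣ) : M) = (v : M ≃ₐ[N] M) u / u := fun v => rfl
  have hfi : Function.Injective f := by
    intro v w hvw
    have h1 : (v : M ≃ₐ[N] M) u = (w : M ≃ₐ[N] M) u := by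
      have := congrArg (fun x : rootsOfUnity r M => ((x : Mˣ) : M)) hvw
      simp only [hf] at this
      exact (div_left_inj' hu0).1 this
    have h2 : (w : M ≃ₐ[N] M)⁻¹ * v = 1 := by
      refine hinj _ ?_ fun t s hs ht => hfix _ (I.mul_mem (I.inv_mem w.2) v.2) t s hs ht
      rw [AlgEquiv.mul_apply, h1]
      exact (w : M ≃ₐ[N] M).symm_apply_apply _
    exact Subtype.ext (inv_mul_eq_one.1 h2).symm
  have hfb := hfi.bijective_of_nat_card_le (by
    rw [hζ.card_rootsOfUnity]
    exact hcard)
  obtain ⟨v, hv⟩ := hfb.2 (rootsOfUnity.mkOfPowEq ζ hζ.pow_eq_one)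
  refine ⟨v, ?_, fun t s hs ht => hfix v v.2 t s hs ht⟩
  rw [← div_eq_iff hu0, ← hf, hv]
  rfl

theorem NumberField.exists_irreducible_of_adjoin_eq_top {K N M : Type*} [Field K] [Field N] [Field M]
    [NumberField K] [NumberField N] [NumberField M] [Algebra K N] [Algebra N M] [Algebra K M]
    [IsScalarTower K N M] [IsGalois K N] [IsGalois K M] {m r : ℕ} (hr : 1 < r)
    (F : IntermediateField K N) (hF : Module.finrank K F = m) {ζ : N} (hζ : IsPrimitiveRoot ζ r)
    {q : Ideal (𝓞 N)} [q.IsMaximal] (hq0 : q ≠ ⊥) (hrq : (r : 𝓞 N) ∉ q) {θ : 𝓞 N} (hθ : θ ∈ q)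
    (hθ2 : θ ∉ q ^ 2) (hθq : ∀ σ : N ≃ₐ[K] N, σ ≠ 1 → σ • θ ∉ q) {u : M}
    (hu : u ^ r = algebraMap N M θ)
    (hM : IntermediateField.adjoin K
      {t : M | ∃ σ : N ≃ₐ[K] N, t ^ r = algebraMap N M (σ θ)} = ⊤) :
    ∃ f : Polynomial K, Irreducible f ∧ f.natDegree = m * r ∧
      ∀ α : AlgebraicClosure K, Polynomial.aeval α f = 0 →
        {x ∈ f.rootSet (AlgebraicClosure K) |
          x ∈ IntermediateField.adjoin K {α}}.ncard = r := by
  have hr0 : r ≠ 0 := by omega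
  have : NeZero r := ⟨hr0⟩
  have : IsGalois N M := IsGalois.tower_top_of_isGalois K N M
  have hζM : IsPrimitiveRoot (algebraMap N M ζ) r := hζ.map_of_injective (algebraMap N M).injective
  have hroot : ∀ x : M, x ^ r = 1 → ∃ y : N, algebraMap N M y = x := fun x hx => by
    obtain ⟨i, _, hi⟩ := hζM.eq_pow_of_pow_eq_one hx
    exact ⟨ζ ^ i, by rw [map_pow, hi]⟩
  have hθ0 : θ ≠ 0 := by rintro rfl; exact hθ2 (zero_mem _)
  have hu0 : u ≠ 0 := fun h => by
    rw [h, zero_pow hr0] at hu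
    exact hθ0 (by simpa using hu.symm)
  have hint : ∀ (t : M) (s : 𝓞 N), t ^ r = algebraMap N M s → IsIntegral ℤ t := fun t s h =>
    IsIntegral.of_pow (Nat.pos_of_ne_zero hr0) (h ▸ (RingOfIntegers.isIntegral_coe s).algebraMap)
  obtain ⟨v, hvu, hvt⟩ := NumberField.exists_algEquiv_apply_eq_mul (M := M) hq0 hθ hθ2 hr0 hrq
    (u := ⟨u, hint u θ hu⟩) (RingOfIntegers.ext hu) hζM (fun v hv hv' => by
      have : v.restrictScalars K = 1 := by
        refine AlgEquiv.eq_one_of_adjoin_eq_top hM fun t ⟨σ, ht⟩ => ?_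
        by_cases hσ : σ = 1
        · rw [hσ, AlgEquiv.one_apply, ← hu] at ht
          obtain ⟨y, hy⟩ := hroot (t / u) (by
            rw [div_pow, ht, div_self (pow_ne_zero r hu0)])
          rw [eq_div_iff hu0] at hy
          rw [← hy, map_mul]
          congr 1
          exact v.commutes y
        · exact hv' ⟨t, hint t (σ • θ) ht⟩ (σ • θ) (hθq σ hσ) (RingOfIntegers.ext ht)
      ext x
      exact DFunLike.congr_fun this x)
  replace hvt : ∀ (t : M) (s : 𝓞 N), s ∉ q → t ^ r = algebraMap N M s → v t = t :=
    fun t s hs ht => hvt ⟨t, hint t s ht⟩ s hs (RingOfIntegers.ext ht)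
  let V : Subgroup (M ≃ₐ[K] M) := (AlgEquiv.restrictNormalHom N).ker
  have hV : ∀ g : M ≃ₐ[K] M, g ∈ V ↔ ∀ x : N, g (algebraMap N M x) = algebraMap N M x := by
    intro g
    rw [MonoidHom.mem_ker]
    refine ⟨fun h x => ?_, fun h => ?_⟩
    · rw [← AlgEquiv.restrictNormal_commutes]
      exact congrArg (algebraMap N M) (DFunLike.congr_fun h x)
    · ext x
      apply (algebraMap N M).injective
      exact (AlgEquiv.restrictNormal_commutes g N x).trans (h x)
  let N₀ : Subgroup (M ≃ₐ[K] M) := (F.map (IsScalarTower.toAlgHom K N M)).fixingSubgroup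
  have hle : V ≤ N₀ := by
    intro g hg
    rw [IntermediateField.mem_fixingSubgroup_iff]
    rintro _ ⟨x, _, rfl⟩
    exact (hV g).1 hg x
  have hpow : ∀ g : V, ((g : M ≃ₐ[K] M) u / u) ^ r = 1 := fun g => by
    rw [div_pow, ← map_pow, hu, (hV g).1 g.2, ← hu, div_self (pow_ne_zero r hu0)]
  let χ : V →* rootsOfUnity r M := MonoidHom.mk' (fun g => rootsOfUnity.mkOfPowEq _ (hpow g))
    (fun g h => by
      ext
      change (g : M ≃ₐ[K] M) ((h : M ≃ₐ[K] M) u) / u =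
        (g : M ≃ₐ[K] M) u / u * ((h : M ≃ₐ[K] M) u / u)
      obtain ⟨y, hy⟩ := hroot _ (hpow h)
      have h1 := (hV g).1 g.2 y
      rw [← hy, ← div_mul_cancel₀ ((h : M ≃ₐ[K] M) u) hu0, ← hy, map_mul, h1]
      ring)
  have hχ : ∀ g : V, ((χ g : Mˣ) : M) = (g : M ≃ₐ[K] M) u / u := fun g => rfl
  let v' : V := ⟨v.restrictScalars K, (hV _).2 fun x => v.commutes x⟩
  have hχv : ((χ v' : Mˣ) : M) = algebraMap N M ζ := by
    rw [hχ, div_eq_iff hu0]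
    exact hvu
  obtain ⟨H, hH, hHr, hHn⟩ := exists_subgroup_normalizer_eq V N₀ hle χ v'
    (fun g hg => by
      ext
      change g.symm (v (g u)) / u = 1
      rw [hvt (g u) (AlgEquiv.restrictNormalHom N g • θ) (hθq _ hg), AlgEquiv.symm_apply_apply,
        div_self hu0]
      rw [← map_pow, hu]
      exact (AlgEquiv.restrictNormal_commutes g N θ).symm)
    (fun a => by
      obtain ⟨i, hi⟩ := hζM.eq_pow_of_pow_eq_one (ξ := ((a : Mˣ) : M)) (by
        rw [← Units.val_pow_eq_pow_val, (mem_rootsOfUnity r _).1 a.2, Units.val_one])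
      refine ⟨i, ?_⟩
      ext
      simpa [hχv] using hi.2)
    (fun h => hζM.ne_one hr (by rw [← hχv, h]; rfl))
  refine exists_irreducible_of_card_algEquiv (L := IntermediateField.fixedField H) ?_ ?_
  · rw [IntermediateField.finrank_eq_fixingSubgroup_index,
      IntermediateField.fixingSubgroup_fixedField, ← Subgroup.relIndex_mul_index hH,
      ← IntermediateField.finrank_eq_fixingSubgroup_index, hHr, hζM.card_rootsOfUnity, mul_comm, ← hF]
    congr 1
    exact (IntermediateField.equivMap F (IsScalarTower.toAlgHom K N M)).toLinearEquiv.finrank_eq.symm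
  · rw [card_algEquiv_fixedField, hHn, hHr, hζM.card_rootsOfUnity]

open Polynomial in
theorem NumberField.irreducible_map_X_pow_add {K : Type*} [Field K] [NumberField K]
    {P : Ideal (𝓞 K)} [hP : P.IsPrime] {n : ℕ} (hn : 0 < n) {R : (𝓞 K)[X]} (hdeg : R.degree < n)
    (hR : ∀ i, R.coeff i ∈ P) (h0 : R.coeff 0 ∉ P ^ 2) :
    Irreducible ((X ^ n + R).map (algebraMap (𝓞 K) K)) := by
  have hmonic : (X ^ n + R).Monic := monic_X_pow_add hdeg
  have hnat : (X ^ n + R).natDegree = n := natDegree_eq_of_degree_eq_some <| by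
    rw [add_comm, degree_add_eq_right_of_degree_lt (by simpa using hdeg), degree_X_pow]
  refine (hmonic.irreducible_iff_irreducible_map_fraction_map).1 ?_
  refine IsEisensteinAt.irreducible (𝓟 := P) ⟨?_, fun {i} hi => ?_, ?_⟩ hP hmonic.isPrimitive
    (hnat.symm ▸ hn)
  · rw [hmonic.leadingCoeff]
    exact fun h => hP.ne_top ((Ideal.eq_top_iff_one P).2 h)
  · rw [hnat] at hi
    rw [coeff_add, coeff_X_pow, if_neg hi.ne, zero_add]
    exact hR i
  · rwa [coeff_add, coeff_X_pow, if_neg hn.ne, zero_add]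

open Polynomial in
theorem NumberField.exists_irreducible_natDegree_eq (K : Type*) [Field K] [NumberField K] {m : ℕ}
    (hm : 0 < m) : ∃ f : K[X], Irreducible f ∧ f.natDegree = m := by
  obtain ⟨P, hP⟩ := Ideal.exists_maximal (𝓞 K)
  have hP0 := Ring.ne_bot_of_isMaximal_of_not_isField hP (RingOfIntegers.not_isField K)
  obtain ⟨d, hd, hd2⟩ : ∃ d ∈ P, d ∉ P ^ 2 := by
    simpa using Ideal.exists_mem_pow_notMem_pow_succ P hP0 hP.ne_top 1
  have hdeg : (C d : (𝓞 K)[X]).degree < m := degree_C_le.trans_lt (by exact_mod_cast hm)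
  refine ⟨_, NumberField.irreducible_map_X_pow_add (P := P) hm (R := C d) hdeg (fun i => ?_)
    (by simpa using hd2), ?_⟩
  · rw [coeff_C]
    split_ifs
    exacts [hd, P.zero_mem]
  · rw [(monic_X_pow_add hdeg).natDegree_map]
    exact natDegree_X_pow_add_C

open Polynomial in
theorem IntermediateField.exists_finrank_eq_of_splits {K N : Type*} [Field K] [Field N] [Algebra K N]
    {g : K[X]} (hg : Irreducible g) (hs : (g.map (algebraMap K N)).Splits) :
    ∃ F : IntermediateField K N, Module.finrank K F = g.natDegree := by
  obtain ⟨a, ha⟩ := hs.exists_eval_eq_zero (by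
    rw [degree_map]
    exact (degree_pos_of_irreducible hg).ne')
  rw [eval_map_algebraMap] at ha
  refine ⟨IntermediateField.adjoin K {a}, ?_⟩
  rw [IntermediateField.adjoin.finrank (IsAlgebraic.isIntegral ⟨g, hg.ne_zero, ha⟩),
    ← minpoly.eq_of_irreducible hg ha, natDegree_mul_C (by simpa using hg.ne_zero)]

open Polynomial in
theorem IsPrimitiveRoot.exists_of_splits_cyclotomic {K N : Type*} [Field K] [Field N] [Algebra K N]
    {r : ℕ} [NeZero (r : N)] (hr : 0 < r) (hs : ((cyclotomic r K).map (algebraMap K N)).Splits) :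
    ∃ ζ : N, IsPrimitiveRoot ζ r := by
  obtain ⟨ζ, hζ⟩ := hs.exists_eval_eq_zero (by
    rw [degree_map]
    exact (degree_cyclotomic_pos r K hr).ne')
  rw [map_cyclotomic] at hζ
  exact ⟨ζ, isRoot_cyclotomic_iff.1 hζ⟩

theorem IntermediateField.adjoin_simple_eq_top_of_forall_apply_ne {K N : Type*} [Field K] [Field N]
    [Algebra K N] [FiniteDimensional K N] [IsGalois K N] {a : N}
    (ha : ∀ σ : N ≃ₐ[K] N, σ a = a → σ = 1) : IntermediateField.adjoin K {a} = ⊤ := by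
  rw [← IsGalois.fixedField_fixingSubgroup (IntermediateField.adjoin K {a}), ← top_le_iff,
    IntermediateField.le_iff_le]
  intro σ hσ
  rw [ha σ ((IntermediateField.mem_fixingSubgroup_iff _ _).1 hσ a
    (IntermediateField.mem_adjoin_simple_self K _))]
  exact one_mem _

open Polynomial in
theorem IntermediateField.exists_algHom_apply_eq {K N M : Type*} [Field K] [Field N] [Field M]
    [Algebra K N] [Algebra K M] {a : N} (ha : IsIntegral K a)
    (htop : IntermediateField.adjoin K {a} = ⊤) {b : M} (hb : aeval b (minpoly K a) = 0) :
    ∃ ι : N →ₐ[K] M, ι a = b :=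
  ⟨((algHomAdjoinIntegralEquiv K ha).symm ⟨b, (mem_aroots).2 ⟨minpoly.ne_zero ha, hb⟩⟩).comp
      ((topEquiv.symm.trans (equivOfEq htop.symm)) : N →ₐ[K] adjoin K {a}),
    algHomAdjoinIntegralEquiv_symm_apply_gen K ha _⟩

open Polynomial in
theorem NumberField.exists_irreducible_of_isSplittingField {K N M : Type*} [Field K] [Field N]
    [Field M] [NumberField K] [NumberField N] [NumberField M] [Algebra K N] [Algebra K M]
    [IsGalois K N] {m r : ℕ} (hr : 1 < r) (F : IntermediateField K N)
    (hF : Module.finrank K F = m) {ζ : N} (hζ : IsPrimitiveRoot ζ r)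
    {q : Ideal (𝓞 N)} [q.IsMaximal] (hq0 : q ≠ ⊥) (hrq : (r : 𝓞 N) ∉ q) {θ : 𝓞 N} (hθ : θ ∈ q)
    (hθ2 : θ ∉ q ^ 2) (hθq : ∀ σ : N ≃ₐ[K] N, σ ≠ 1 → σ • θ ∉ q)
    [hf : (expand K r (minpoly K (θ : N))).IsSplittingField K M] :
    ∃ f : Polynomial K, Irreducible f ∧ f.natDegree = m * r ∧
      ∀ α : AlgebraicClosure K, Polynomial.aeval α f = 0 →
        {x ∈ f.rootSet (AlgebraicClosure K) |
          x ∈ IntermediateField.adjoin K {α}}.ncard = r := by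
  have hi : IsIntegral K (θ : N) := Algebra.IsIntegral.isIntegral _
  have htop := IntermediateField.adjoin_simple_eq_top_of_forall_apply_ne (K := K) (a := (θ : N))
    fun σ h => by_contra fun hσ =>
      hθq σ hσ (by rwa [show σ • θ = θ from RingOfIntegers.ext h])
  have : IsGalois K M :=
    { to_normal := Normal.of_isSplittingField (expand K r (minpoly K (θ : N))) }
  obtain ⟨u, hu⟩ := hf.splits.exists_eval_eq_zero (by
    rw [degree_map]
    refine (natDegree_pos_iff_degree_pos.1 ?_).ne'
    rw [natDegree_expand]
    exact Nat.mul_pos (minpoly.natDegree_pos hi) (by omega))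
  rw [eval_map_algebraMap, expand_aeval] at hu
  obtain ⟨ι, hι⟩ := IntermediateField.exists_algHom_apply_eq hi htop hu
  let _ : Algebra N M := ι.toAlgebra
  have : IsScalarTower K N M := IsScalarTower.of_algebraMap_eq fun x => (ι.commutes x).symm
  refine NumberField.exists_irreducible_of_adjoin_eq_top hr F hF hζ hq0 hrq hθ hθ2 hθq hι.symm ?_
  rw [← top_le_iff, ← IntermediateField.adjoin_eq_top_of_algebra _ _ hf.adjoin_rootSet]
  refine IntermediateField.adjoin.mono _ _ _ fun t ht => ?_
  have ht := (mem_rootSet.1 ht).2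
  rw [expand_aeval] at ht
  obtain ⟨τ, hτ⟩ := minpoly.exists_algEquiv_of_root' (K := K) (x := t ^ r) (y := ι θ)
    (Algebra.IsAlgebraic.isAlgebraic _) (by rwa [minpoly.algHom_eq ι ι.injective])
  refine ⟨AlgEquiv.restrictNormalHom N τ, ?_⟩
  rw [← hτ]
  exact (AlgEquiv.restrictNormal_commutes τ N θ).symm

open Polynomial in
theorem NumberField.exists_isSplittingField.{u} {K : Type u} [Field K] [NumberField K] (f : K[X]) :
    ∃ (M : Type u) (_ : Field M) (_ : NumberField M) (_ : Algebra K M), f.IsSplittingField K M :=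
  ⟨f.SplittingField, inferInstance, NumberField.of_module_finite K _, inferInstance, inferInstance⟩

open Polynomial in
theorem NumberField.exists_irreducible_of_splits {K N : Type*} [Field K] [Field N]
    [NumberField K] [NumberField N] [Algebra K N] [IsGalois K N] {m r : ℕ} (hr : 1 < r)
    {g : K[X]} (hg : Irreducible g) (hgm : g.natDegree = m)
    (hN : ((g * cyclotomic r K).map (algebraMap K N)).Splits) :
    ∃ f : Polynomial K, Irreducible f ∧ f.natDegree = m * r ∧
      ∀ α : AlgebraicClosure K, Polynomial.aeval α f = 0 →
        {x ∈ f.rootSet (AlgebraicClosure K) |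
          x ∈ IntermediateField.adjoin K {α}}.ncard = r := by
  have hg0 : (g * cyclotomic r K).map (algebraMap K N) ≠ 0 :=
    Polynomial.map_ne_zero (mul_ne_zero hg.ne_zero (cyclotomic_ne_zero r K))
  have hN1 : (g.map (algebraMap K N)).Splits :=
    hN.of_dvd hg0 (Polynomial.map_dvd (algebraMap K N) (dvd_mul_right g (cyclotomic r K)))
  have hN2 : ((cyclotomic r K).map (algebraMap K N)).Splits :=
    hN.of_dvd hg0 (Polynomial.map_dvd (algebraMap K N) (dvd_mul_left (cyclotomic r K) g))
  have : NeZero (r : N) := ⟨by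
    rw [Nat.cast_ne_zero]
    omega⟩
  obtain ⟨F, hF⟩ := IntermediateField.exists_finrank_eq_of_splits hg hN1
  obtain ⟨ζ, hζ⟩ := IsPrimitiveRoot.exists_of_splits_cyclotomic (zero_lt_one.trans hr) hN2
  obtain ⟨q, θ, hq, hq0, hrq, hθ, hθ2, hθq⟩ :=
    NumberField.exists_mem_maximalIdeal_forall_smul_notMem K N (r := r) (by omega)
  obtain ⟨M, _, _, _, _⟩ :=
    NumberField.exists_isSplittingField (expand K r (minpoly K (θ : N)))
  exact NumberField.exists_irreducible_of_isSplittingField (M := M) hr F (hF.trans hgm) hζ hq0 hrq hθ hθ2 hθq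

open Polynomial in
theorem NumberField.exists_irreducible_of_one_lt (K : Type*) [Field K] [NumberField K] {m r : ℕ}
    (hm : 0 < m) (hr : 1 < r) :
    ∃ f : Polynomial K, Irreducible f ∧ f.natDegree = m * r ∧
      ∀ α : AlgebraicClosure K, Polynomial.aeval α f = 0 →
        {x ∈ f.rootSet (AlgebraicClosure K) |
          x ∈ IntermediateField.adjoin K {α}}.ncard = r := by
  obtain ⟨g, hg, hgm⟩ := NumberField.exists_irreducible_natDegree_eq K hm
  obtain ⟨N, _, _, _, hN⟩ := NumberField.exists_isSplittingField (g * cyclotomic r K)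
  have : IsGalois K N := { to_normal := Normal.of_isSplittingField (g * cyclotomic r K) }
  exact NumberField.exists_irreducible_of_splits hr hg hgm hN.splits

open Polynomial in
theorem Ideal.exists_isPrime_liesOver_sub_mem {R S : Type*} [CommRing R] [IsDomain R]
    [IsIntegrallyClosed R] [CommRing S] [IsDomain S] [Algebra R S] [Module.IsTorsionFree R S]
    [Algebra.IsIntegral R S] {q : Ideal R} [hq : q.IsMaximal] {α : S} {a : R}
    (h : (minpoly R α).eval a ∈ q) :
    ∃ Q : Ideal S, Q.IsPrime ∧ Q.LiesOver q ∧ α - algebraMap R S a ∈ Q := by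
  have hα : IsIntegral R α := Algebra.IsIntegral.isIntegral α
  let A := Algebra.adjoin R {α}
  let α' : A := ⟨α, Algebra.self_mem_adjoin_singleton R α⟩
  have h0 : eval₂ ((Algebra.ofId R (R ⧸ q) : R →ₐ[R] R ⧸ q) : R →+* R ⧸ q) (Ideal.Quotient.mk q a)
      (minpoly R α) = 0 := by
    change eval₂ (Ideal.Quotient.mk q) _ _ = 0
    rw [eval₂_at_apply, Ideal.Quotient.eq_zero_iff_mem]
    exact h
  let ψ := AdjoinRoot.liftAlgHom (minpoly R α) (Algebra.ofId R (R ⧸ q)) (Ideal.Quotient.mk q a) h0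
  let φ : A →ₐ[R] R ⧸ q := ψ.comp (minpoly.equivAdjoin hα).symm.toAlgHom
  have hφ : φ α' = Ideal.Quotient.mk q a := by
    have : (minpoly.equivAdjoin hα).symm α' = AdjoinRoot.root _ := by
      rw [AlgEquiv.symm_apply_eq]
      ext
      simp [α', minpoly.coe_equivAdjoin, AdjoinRoot.Minpoly.toAdjoin]
    exact (congrArg ψ this).trans (AdjoinRoot.liftAlgHom_root ..)
  have hP : (RingHom.ker φ).IsPrime := RingHom.ker_isPrime φ
  have : Algebra.IsIntegral A S := Algebra.IsIntegral.tower_top R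
  obtain ⟨Q, -, hQ, hQP⟩ := Ideal.exists_ideal_over_prime_of_isIntegral (RingHom.ker φ)
    (⊥ : Ideal S) (by
      intro x hx
      have : x = 0 := Subtype.ext hx
      rw [this]
      exact zero_mem _)
  have hmem : ∀ x : A, (x : S) ∈ Q ↔ φ x = 0 := fun x => by
    rw [← RingHom.mem_ker, ← hQP]
    rfl
  refine ⟨Q, hQ, ⟨?_⟩, ?_⟩
  · refine hq.eq_of_le (Ideal.IsPrime.under R Q).ne_top fun x hx => ?_
    refine (hmem (algebraMap R A x)).2 ?_
    rw [AlgHom.commutes]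
    exact Ideal.Quotient.eq_zero_iff_mem.2 hx
  · refine (hmem (α' - algebraMap R A a)).2 ?_
    rw [map_sub, hφ, AlgHom.commutes]
    exact sub_self _

theorem eq_of_pow_mul_sub_eq_of_sub_one_mem {R : Type*} [CommRing R] [IsDomain R] {Q : Ideal R}
    (hQ : Q ≠ ⊤) {n : ℕ} {a b c d : R} (ha : a ^ n * (a - c) = d) (hb : b ^ n * (b - c) = d)
    (ha1 : a - 1 ∈ Q) (hb1 : b - 1 ∈ Q) (hc1 : c - 1 ∈ Q) : a = b := by
  by_contra hab
  have h1 := geom_sum₂_mul a b (n + 1)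
  have h2 := geom_sum₂_mul a b n
  have h3 : (∑ i ∈ Finset.range (n + 1), a ^ i * b ^ (n + 1 - 1 - i)) -
      c * ∑ i ∈ Finset.range n, a ^ i * b ^ (n - 1 - i) = 0 := by
    refine (mul_eq_zero.1 ?_).resolve_right (sub_ne_zero.2 hab)
    linear_combination h1 - c * h2 + ha - hb
  have h4 := congrArg (Ideal.Quotient.mk Q) h3
  have e : ∀ {x : R}, x - 1 ∈ Q → Ideal.Quotient.mk Q x = 1 := fun h => by
    rw [← map_one (Ideal.Quotient.mk Q)]
    exact Ideal.Quotient.eq.2 h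
  have : Nontrivial (R ⧸ Q) := Ideal.Quotient.nontrivial_iff.2 hQ
  simp [e ha1, e hb1, e hc1] at h4

theorem NumberField.algEquiv_apply_eq_of_pow_mul_sub_eq {K F : Type*} [Field K] [Field F]
    [NumberField K] [NumberField F] [Algebra K F] {n : ℕ} (hn : 2 ≤ n)
    (hF : Module.finrank K F = n + 1) {q : Ideal (𝓞 K)} [hq : q.IsMaximal] (hq0 : q ≠ ⊥)
    {c d : 𝓞 K} (hd : d ∈ q) (hd2 : d ∉ q ^ 2) (hc : c - 1 ∈ q) {Q : Ideal (𝓞 F)} [hQ : Q.IsPrime]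
    [hQq : Q.LiesOver q] {α : 𝓞 F} (hαQ : α - 1 ∈ Q)
    (hα : α ^ n * (α - algebraMap (𝓞 K) (𝓞 F) c) = algebraMap (𝓞 K) (𝓞 F) d) (σ : F ≃ₐ[K] F) :
    σ • α = α := by
  classical
  have hσ : ∀ (σ : F ≃ₐ[K] F) (x : 𝓞 K), σ • algebraMap (𝓞 K) (𝓞 F) x = algebraMap (𝓞 K) (𝓞 F) x :=
    fun σ x => RingOfIntegers.ext (σ.commutes x)
  have : SMulCommClass (F ≃ₐ[K] F) (𝓞 K) (𝓞 F) := ⟨fun g a x => by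
    rw [Algebra.smul_def, Algebra.smul_def, smul_mul', hσ]⟩
  have hc' : ∀ (P : Ideal (𝓞 F)) [P.LiesOver q], algebraMap (𝓞 K) (𝓞 F) c - 1 ∈ P := fun P _ => by
    simpa using (Ideal.mem_of_liesOver P q _).1 hc
  have hσα : (σ • α) ^ n * (σ • α - algebraMap (𝓞 K) (𝓞 F) c) = algebraMap (𝓞 K) (𝓞 F) d := by
    rw [← hσ σ c, ← hσ σ d, ← hα, smul_mul', smul_pow', smul_sub]
  have hram : ∀ (P : Ideal (𝓞 F)) [P.IsPrime] [P.LiesOver q], α ∈ P →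
      n ≤ P.ramificationIdx (𝓞 K) * P.inertiaDeg (𝓞 K) := fun P hP _ h => by
    refine le_mul_of_le_of_one_le ?_ (Ideal.inertiaDeg_pos ..)
    refine NumberField.le_ramificationIdx_of_mem_pow hq0 P hd2 ?_
    rw [← hα]
    exact Ideal.mul_mem_right _ _ (Ideal.pow_mem_pow h n)
  have hram' : ∀ (P : Ideal (𝓞 F)) [P.IsPrime] [P.LiesOver q], σ • α ∈ P →
      n ≤ P.ramificationIdx (𝓞 K) * P.inertiaDeg (𝓞 K) := fun P hP _ h => by
    refine le_mul_of_le_of_one_le ?_ (Ideal.inertiaDeg_pos ..)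
    refine NumberField.le_ramificationIdx_of_mem_pow hq0 P hd2 ?_
    rw [← hσα]
    exact Ideal.mul_mem_right _ _ (Ideal.pow_mem_pow h n)
  have hdQ : (σ • α) ^ n * (σ • α - algebraMap (𝓞 K) (𝓞 F) c) ∈ Q := by
    rw [hσα]
    exact (Ideal.mem_of_liesOver Q q _).1 hd
  rcases hQ.mem_or_mem hdQ with h | h
  · replace h := hQ.mem_of_pow_mem _ h
    exfalso
    let Q' := σ⁻¹ • Q
    have hαQ' : α ∈ Q' := by
      rw [Ideal.mem_inv_pointwise_smul_iff]
      exact h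
    have hne : Q ≠ Q' := fun hQQ => hQ.ne_top <| (Ideal.eq_top_iff_one Q).2 <| by
      have := Q.sub_mem (hQQ ▸ hαQ') hαQ
      rwa [sub_sub_cancel] at this
    have h1 := hram' Q h
    have h2 := hram Q' hαQ'
    let _ : Fintype (q.primesOver (𝓞 F)) := Fintype.ofFinite _
    have hsum := Ideal.sum_ramification_inertia_eq_finrank q (𝓞 F)
    rw [← IsFractionRing.finrank_eq (𝓞 K) K (𝓞 F) F, hF] at hsum
    have h3 := Finset.add_le_sum (f := fun P : q.primesOver (𝓞 F) =>
      P.1.ramificationIdx (𝓞 K) * P.1.inertiaDeg (𝓞 K)) (fun _ _ => Nat.zero_le _)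
      (Finset.mem_univ (⟨Q, hQ, hQq⟩ : q.primesOver (𝓞 F)))
      (Finset.mem_univ (⟨Q', inferInstance, inferInstance⟩ : q.primesOver (𝓞 F)))
      (fun h => hne (congrArg Subtype.val h))
    rw [hsum] at h3
    have h4 := (add_le_add h1 h2).trans h3
    omega
  · refine eq_of_pow_mul_sub_eq_of_sub_one_mem hQ.ne_top hσα hα ?_ hαQ (hc' Q)
    simpa using Q.add_mem h (hc' Q)

theorem NumberField.exists_mem_maximalIdeals (K : Type*) [Field K] [NumberField K] :
    ∃ (p q : Ideal (𝓞 K)) (c d : 𝓞 K), p.IsMaximal ∧ q.IsMaximal ∧ q ≠ ⊥ ∧ c ∈ p ∧ c - 1 ∈ q ∧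
      d ∈ p ∧ d ∉ p ^ 2 ∧ d ∈ q ∧ d ∉ q ^ 2 := by
  have key : ∀ p : Ideal (𝓞 K), p.IsMaximal → p ≠ ⊥ ∧ ∃ d ∈ p, d ∉ p ^ 2 := fun p hp => by
    have hp0 := Ring.ne_bot_of_isMaximal_of_not_isField hp (RingOfIntegers.not_isField K)
    exact ⟨hp0, by simpa using Ideal.exists_mem_pow_notMem_pow_succ p hp0 hp.ne_top 1⟩
  obtain ⟨p, hp⟩ := Ideal.exists_maximal (𝓞 K)
  obtain ⟨-, s, hs, hs2⟩ := key p hp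
  have hs0 : s ≠ 0 := by
    rintro rfl
    exact hs2 (zero_mem _)
  obtain ⟨k, hk⟩ := NumberField.exists_natCast_mul_sub_one_not_isUnit hs0
  obtain ⟨q, hq, hkq⟩ := exists_max_ideal_of_mem_nonunits hk
  obtain ⟨hq0, t, ht, ht2⟩ := key q hq
  have hpq : p ≠ q := by
    rintro rfl
    refine hp.ne_top ((Ideal.eq_top_iff_one p).2 ?_)
    have := p.sub_mem (p.mul_mem_left (k : 𝓞 K) hs) hkq
    rwa [sub_sub_cancel] at this
  obtain ⟨e, he, e', he', hee⟩ := Ideal.isCoprime_iff_exists.1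
    ((Ideal.isCoprime_of_isMaximal hpq).pow (m := 2) (n := 2))
  have hep := Ideal.pow_le_self two_ne_zero he
  have heq := Ideal.pow_le_self two_ne_zero he'
  refine ⟨p, q, e, s * e' + t * e, hp, hq, hq0, hep, ?_, ?_, fun h => hs2 ?_, ?_, fun h => ht2 ?_⟩
  · rw [← hee, sub_add_cancel_left]
    exact q.neg_mem heq
  · exact p.add_mem (p.mul_mem_right _ hs) (p.mul_mem_left _ hep)
  · have : s = s * e' + t * e + (s - t) * e := by linear_combination -s * hee
    rw [this]
    exact (p ^ 2).add_mem h ((p ^ 2).mul_mem_left _ he)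
  · exact q.add_mem (q.mul_mem_left _ heq) (q.mul_mem_right _ ht)
  · have : t = s * e' + t * e + (t - s) * e' := by linear_combination -t * hee
    rw [this]
    exact (q ^ 2).add_mem h ((q ^ 2).mul_mem_left _ he')

open Polynomial in
theorem NumberField.exists_adjoin_root_eq_top.{u} {K : Type u} [Field K] [NumberField K] {f : K[X]}
    (hf : Irreducible f) :
    ∃ (F : Type u) (_ : Field F) (_ : NumberField F) (_ : Algebra K F) (a : F),
      aeval a f = 0 ∧ IntermediateField.adjoin K {a} = ⊤ := by
  have := Fact.mk hf
  have : FiniteDimensional K (AdjoinRoot f) := (AdjoinRoot.powerBasis hf.ne_zero).finite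
  exact ⟨AdjoinRoot f, inferInstance, NumberField.of_module_finite K _, inferInstance,
    AdjoinRoot.root f, by rw [AdjoinRoot.aeval_eq, AdjoinRoot.mk_self],
    IntermediateField.adjoin_eq_top_of_algebra _ _ AdjoinRoot.adjoinRoot_eq_top⟩

open Polynomial in
theorem NumberField.exists_irreducible_of_two_lt (K : Type*) [Field K] [NumberField K] {n : ℕ}
    (hn : 2 < n) :
    ∃ f : Polynomial K, Irreducible f ∧ f.natDegree = n ∧
      ∀ α : AlgebraicClosure K, Polynomial.aeval α f = 0 →
        {x ∈ f.rootSet (AlgebraicClosure K) |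
          x ∈ IntermediateField.adjoin K {α}}.ncard = 1 := by
  obtain ⟨n, rfl⟩ : ∃ k, n = k + 1 := ⟨n - 1, by omega⟩
  obtain ⟨p, q, c, d, hp, hq, hq0, hcp, hcq, hdp, hdp2, hdq, hdq2⟩ :=
    NumberField.exists_mem_maximalIdeals K
  let R : (𝓞 K)[X] := -(C c * X ^ n + C d)
  have hdeg : R.degree < (n + 1 : ℕ) := by
    rw [degree_neg]
    refine (degree_add_le _ _).trans_lt (max_lt ?_ ?_)
    · exact (degree_C_mul_X_pow_le _ _).trans_lt (by exact_mod_cast n.lt_succ_self)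
    · exact degree_C_le.trans_lt (by exact_mod_cast n.succ_pos)
  have hmonic : (X ^ (n + 1) + R).Monic := monic_X_pow_add hdeg
  have hcoeff : ∀ i, R.coeff i = -((if i = n then c else 0) + if i = 0 then d else 0) := fun i => by
    simp only [R, coeff_neg, coeff_add, coeff_C_mul_X_pow, coeff_C]
  have hirr := NumberField.irreducible_map_X_pow_add (P := p) n.succ_pos hdeg (fun i => by
    rw [hcoeff]
    refine p.neg_mem (p.add_mem ?_ ?_)
    · split_ifs
      exacts [hcp, p.zero_mem]
    · split_ifs
      exacts [hdp, p.zero_mem]) (by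
    rw [hcoeff, if_neg (by omega), if_pos rfl, zero_add, neg_mem_iff]
    exact hdp2)
  obtain ⟨F, _, _, _, a, ha, htop⟩ := NumberField.exists_adjoin_root_eq_top hirr
  have hmin := minpoly.eq_of_irreducible_of_monic hirr ha (hmonic.map _)
  have hai : IsIntegral K a := Algebra.IsIntegral.isIntegral a
  have hF : Module.finrank K F = n + 1 := by
    rw [← IntermediateField.finrank_top', ← htop, IntermediateField.adjoin.finrank hai, ← hmin,
      hmonic.natDegree_map]
    refine natDegree_eq_of_degree_eq_some ?_
    rw [add_comm, degree_add_eq_right_of_degree_lt (by rwa [degree_X_pow]), degree_X_pow]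
  rw [aeval_map_algebraMap] at ha
  let α : 𝓞 F := ⟨a, isIntegral_trans (R := ℤ) (A := 𝓞 K) a ⟨_, hmonic, ha⟩⟩
  have hαi : IsIntegral (𝓞 K) α := Algebra.IsIntegral.isIntegral α
  have hα0 : aeval α (X ^ (n + 1) + R) = 0 := by
    apply RingOfIntegers.ext
    have := aeval_algebraMap_apply F α (X ^ (n + 1) + R)
    exact this.symm.trans ha
  have hα : α ^ n * (α - algebraMap (𝓞 K) (𝓞 F) c) = algebraMap (𝓞 K) (𝓞 F) d := by
    simp only [R, map_add, map_neg, map_mul, aeval_X_pow, aeval_C] at hα0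
    linear_combination hα0
  have hmin' : minpoly (𝓞 K) α = X ^ (n + 1) + R := by
    apply map_injective _ (RingOfIntegers.coe_injective (K := K))
    exact (minpoly.isIntegrallyClosed_eq_field_fractions K F hαi).symm.trans hmin.symm
  obtain ⟨Q, hQ, hQq, hαQ⟩ := Ideal.exists_isPrime_liesOver_sub_mem (q := q) (α := α) (a := 1) (by
    rw [hmin']
    have : eval 1 (X ^ (n + 1) + R) = -((c - 1) + d) := by
      simp [R]
      ring
    rw [this]
    exact q.neg_mem (q.add_mem hcq hdq))
  rw [map_one] at hαQ
  refine exists_irreducible_of_card_algEquiv hF ?_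
  rw [Nat.card_eq_one_iff_unique]
  refine ⟨⟨fun σ τ => ?_⟩, ⟨1⟩⟩
  have key : ∀ σ : F ≃ₐ[K] F, σ = 1 := fun σ => by
    refine AlgEquiv.eq_one_of_adjoin_eq_top htop fun x hx => ?_
    rw [Set.mem_singleton_iff.1 hx]
    exact congrArg (algebraMap (𝓞 F) F) (NumberField.algEquiv_apply_eq_of_pow_mul_sub_eq
      (by omega) hF hq0 hdq hdq2 hcq hαQ hα σ)
  rw [key σ, key τ]

/-- Let `K` be a number field. For any integers `n > 2` and `r ≥ 1` with `r ∣ n`,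
there exists an irreducible polynomial `f` over `K` of degree `n` whose cluster size over `K`
equals `r`: for any root `α` of `f` in a fixed algebraic closure of `K`, exactly `r` of the
roots of `f` lie in `K(α)`. -/
theorem stmt_0 (K : Type*) [Field K] [NumberField K] (n r : ℕ)
    (hn : 2 < n) (hr : 1 ≤ r) (hdvd : r ∣ n) :
    ∃ f : Polynomial K, Irreducible f ∧ f.natDegree = n ∧
      ∀ α : AlgebraicClosure K, Polynomial.aeval α f = 0 →
        {x ∈ f.rootSet (AlgebraicClosure K) |
          x ∈ IntermediateField.adjoin K {α}}.ncard = r := by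
  obtain rfl | hr := hr.eq_or_lt
  · exact NumberField.exists_irreducible_of_two_lt K hn
  · obtain ⟨m, rfl⟩ := hdvd
    rw [mul_comm r m]
    refine NumberField.exists_irreducible_of_one_lt K (Nat.pos_of_ne_zero ?_) hr
    rintro rfl
    omega
end

section
/- For every number field K and every natural number n, the symmetric group S_n is realisable as a Galois group over K; that is, there exists a finite Galois extension E/K with Gal(E/K) isomorphic to S_n. -/
open Polynomial NumberField

theorem Polynomial.eq_of_mk_eq_of_separable_map {B : Type*} [CommRing B] [IsDomain B]
    (Q : Ideal B) [Q.IsPrime] {f : B[X]} (hf : (f.map (Ideal.Quotient.mk Q)).Separable) {x y : B}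
    (hx : f.IsRoot x) (hy : f.IsRoot y)
    (hxy : Ideal.Quotient.mk Q x = Ideal.Quotient.mk Q y) : x = y := by
  by_contra hne
  obtain ⟨g, rfl⟩ := dvd_iff_isRoot.mpr hx
  have hg : g.eval y = 0 := by
    have := hy
    rw [IsRoot, eval_mul, eval_sub, eval_X, eval_C] at this
    exact (mul_eq_zero.mp this).resolve_left (sub_ne_zero.mpr (Ne.symm hne))
  rw [Polynomial.map_mul] at hf
  obtain ⟨a, b, hab⟩ := hf.isCoprime
  have := congrArg (eval (Ideal.Quotient.mk Q y)) hab
  simp [eval_map, eval₂_at_apply, hg, hxy] at this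

theorem Subgroup.eq_top_of_isSwap_mem {α : Type*} [Finite α] [DecidableEq α]
    (H : Subgroup (Equiv.Perm α))
    (htrans : ∀ x y, ∃ σ ∈ H, σ x = y) (a : α)
    (hstab : ∀ x y, x ≠ a → y ≠ a → ∃ σ ∈ H, σ a = a ∧ σ x = y)
    (τ : Equiv.Perm α) (hτ : τ ∈ H) (hswap : τ.IsSwap) : H = ⊤ := by
  have key (x y u v : α) (hxy : x ≠ y) (huv : u ≠ v) : ∃ σ ∈ H, σ x = u ∧ σ y = v := by
    obtain ⟨σ, hσ, hx⟩ := htrans x a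
    obtain ⟨ρ, hρ, hu⟩ := htrans u a
    obtain ⟨κ, hκ, ha, hv⟩ := hstab (σ y) (ρ v) (fun h ↦ hxy (σ.injective (hx.trans h.symm)))
      (fun h ↦ huv (ρ.injective (hu.trans h.symm)))
    refine ⟨ρ⁻¹ * κ * σ, H.mul_mem (H.mul_mem (H.inv_mem hρ) hκ) hσ, ?_, ?_⟩
    · simp [hx, ha, Equiv.symm_apply_eq, hu]
    · simp [hv]
  rw [eq_top_iff, ← Equiv.Perm.closure_isSwap, Subgroup.closure_le]
  obtain ⟨x, y, hxy, rfl⟩ := hswap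
  rintro _ ⟨u, v, huv, rfl⟩
  obtain ⟨σ, hσ, rfl, rfl⟩ := key x y u v hxy huv
  rw [Equiv.swap_apply_apply]
  exact H.mul_mem (H.mul_mem hσ hτ) (H.inv_mem hσ)

theorem Polynomial.exists_monic_map_quotient_eq {A ι : Type*} [CommRing A] [Finite ι]
    {I : ι → Ideal A} (hI : Pairwise (Function.onFun IsCoprime I)) (n : ℕ)
    (g : ∀ i, (A ⧸ I i)[X]) (hg : ∀ i, (g i).Monic) (hn : ∀ i, (g i).natDegree = n) :
    ∃ f : A[X], f.Monic ∧ ∀ i, f.map (algebraMap A (A ⧸ I i)) = g i := by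
  choose l hl using fun i k ↦ Ideal.Quotient.mk_surjective ((g i).coeff k)
  choose c hc using fun k ↦ Ideal.exists_forall_sub_mem_ideal hI (fun i ↦ l i k)
  have hc' (i k) : algebraMap A (A ⧸ I i) (c k) = (g i).coeff k := by
    rw [← hl i k]
    exact Ideal.Quotient.mk_eq_mk_iff_sub_mem _ _ |>.mpr (hc k i)
  refine ⟨X ^ n + ∑ k ∈ Finset.range n, C (c k) * X ^ k,
    monic_X_pow_add ?_, fun i ↦ ?_⟩
  · refine (degree_sum_le _ _).trans_lt ?_
    refine (Finset.sup_lt_iff (WithBot.bot_lt_coe n)).mpr fun k hk ↦ ?_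
    exact (degree_C_mul_X_pow_le _ _).trans_lt (Nat.cast_lt.mpr (Finset.mem_range.mp hk))
  · rw [(hg i).as_sum, hn]
    simp_rw [Polynomial.map_add, Polynomial.map_sum, Polynomial.map_mul, Polynomial.map_pow, map_X,
      map_C, hc']

theorem FiniteField.exists_monic_irreducible_natDegree_eq (k : Type*) [Field k] [Finite k]
    {n : ℕ} (hn : n ≠ 0) :
    ∃ g : k[X], g.Monic ∧ Irreducible g ∧ g.natDegree = n ∧ g.eval 0 ≠ 0 := by
  obtain ⟨p, _⟩ := CharP.exists k
  have : Fact p.Prime := ⟨CharP.char_is_prime k p⟩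
  have : NeZero n := ⟨hn⟩
  obtain rfl | h1 := eq_or_ne n 1
  · exact ⟨X - C 1, monic_X_sub_C 1, irreducible_X_sub_C 1, natDegree_X_sub_C 1, by simp⟩
  let l := FiniteField.Extension k p n
  obtain ⟨α, hα⟩ := Field.exists_primitive_element k l
  have hi : IsIntegral k α := .of_finite k α
  have hd : (minpoly k α).natDegree = n := by
    rw [← IntermediateField.adjoin.finrank hi, hα, IntermediateField.finrank_top',
      FiniteField.finrank_extension]
  refine ⟨minpoly k α, minpoly.monic hi, minpoly.irreducible hi, hd, fun h ↦ ?_⟩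
  exact h1 (hd ▸ natDegree_eq_of_degree_eq_some
    (degree_eq_one_of_irreducible_of_root (minpoly.irreducible hi) h))

section
variable {A B G : Type*} [CommRing A] [CommRing B] [Algebra A B] [IsDomain B] [Group G] [Finite G]
  [MulSemiringAction G B] [SMulCommClass G A B] [Algebra.IsInvariant A B G]

theorem Polynomial.injOn_mk_rootSet (p : Ideal A) (Q : Ideal B) [Q.IsPrime] [Q.LiesOver p]
    {f : A[X]} (hf : (f.map (algebraMap A (A ⧸ p))).Separable) {z w : f.rootSet B}
    (h : Ideal.Quotient.mk Q z = Ideal.Quotient.mk Q w) : z = w := by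
  have hsep : ((f.map (algebraMap A B)).map (Ideal.Quotient.mk Q)).Separable := by
    convert hf.map (f := algebraMap (A ⧸ p) (B ⧸ Q)) using 1
    rw [Polynomial.map_map, Polynomial.map_map]
    rfl
  refine Subtype.ext (eq_of_mk_eq_of_separable_map Q hsep ?_ ?_ h)
  · rw [IsRoot, eval_map_algebraMap]; exact aeval_eq_zero_of_mem_rootSet z.2
  · rw [IsRoot, eval_map_algebraMap]; exact aeval_eq_zero_of_mem_rootSet w.2

variable (G) in
attribute [local instance] Ideal.Quotient.field in
theorem Polynomial.exists_smul_eq_of_irreducible_mod (p : Ideal A) [p.IsMaximal]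
    (Q : Ideal B) [Q.IsMaximal] [Q.LiesOver p]
    {f : A[X]} (hf : (f.map (algebraMap A (A ⧸ p))).Separable)
    {g : (A ⧸ p)[X]} (hg : Irreducible g) (x y : f.rootSet B)
    (hx : aeval (Ideal.Quotient.mk Q x) g = 0) (hy : aeval (Ideal.Quotient.mk Q y) g = 0) :
    ∃ σ : G, σ • x = y ∧ ∀ z : f.rootSet B,
      Ideal.Quotient.mk Q z ∈ Set.range (algebraMap (A ⧸ p) (B ⧸ Q)) → σ • z = z := by
  have : Normal (A ⧸ p) (B ⧸ Q) := Ideal.Quotient.normal G p Q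
  have hint : IsIntegral (A ⧸ p) (Ideal.Quotient.mk Q x.1) := Normal.isIntegral this _
  have hroot : aeval (Ideal.Quotient.mk Q y.1) (minpoly (A ⧸ p) (Ideal.Quotient.mk Q x.1)) = 0 := by
    rw [← minpoly.eq_of_irreducible hg hx, map_mul, hy, zero_mul]
  obtain ⟨τ, hτ⟩ := minpoly.exists_algEquiv_of_root' hint.isAlgebraic hroot
  obtain ⟨σ, rfl⟩ := Ideal.Quotient.stabilizerHom_surjective G p Q τ
  refine ⟨σ, injOn_mk_rootSet p Q hf hτ, ?_⟩
  rintro z ⟨a, ha⟩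
  refine injOn_mk_rootSet p Q hf ?_
  have := AlgEquiv.commutes (Ideal.Quotient.stabilizerHom Q p G σ) a
  rw [ha] at this
  exact this

omit [IsDomain B] in
theorem Polynomial.aeval_mk_map_quotient (p : Ideal A) (Q : Ideal B) [Q.LiesOver p]
    (f : A[X]) (x : B) :
    aeval (Ideal.Quotient.mk Q x) (f.map (algebraMap A (A ⧸ p))) =
      Ideal.Quotient.mk Q (aeval x f) := by
  rw [aeval_map_algebraMap]
  exact aeval_algHom_apply (Ideal.Quotient.mkₐ A Q) x f

variable (G) in
theorem Polynomial.exists_smul_eq_of_irreducible_map (p : Ideal A) [p.IsMaximal]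
    (Q : Ideal B) [Q.IsMaximal] [Q.LiesOver p]
    {f : A[X]} (hf : (f.map (algebraMap A (A ⧸ p))).Separable)
    (hirr : Irreducible (f.map (algebraMap A (A ⧸ p)))) (x y : f.rootSet B) :
    ∃ σ : G, σ • x = y := by
  obtain ⟨σ, hσ, -⟩ := exists_smul_eq_of_irreducible_mod G p Q hf hirr x y
    (by rw [aeval_mk_map_quotient, aeval_eq_zero_of_mem_rootSet x.2, map_zero])
    (by rw [aeval_mk_map_quotient, aeval_eq_zero_of_mem_rootSet y.2, map_zero])
  exact ⟨σ, hσ⟩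

theorem Polynomial.exists_rootSet_mk_eq (p : Ideal A) [p.IsMaximal]
    (Q : Ideal B) [Q.IsMaximal] [Q.LiesOver p]
    {f : A[X]} (hf : f.Monic) (hs : (f.map (algebraMap A B)).Splits) {x : B ⧸ Q}
    (hx : aeval x (f.map (algebraMap A (A ⧸ p))) = 0) :
    ∃ z : f.rootSet B, Ideal.Quotient.mk Q z = x := by
  have h0 : f.map (algebraMap A (B ⧸ Q)) ≠ 0 := (hf.map _).ne_zero
  have := hs.image_rootSet_of_map_ne_zero (Ideal.Quotient.mkₐ A Q) h0
  have hx' : x ∈ f.rootSet (B ⧸ Q) := by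
    rw [mem_rootSet']
    exact ⟨h0, by rwa [aeval_map_algebraMap] at hx⟩
  rw [← this] at hx'
  obtain ⟨z, hz, rfl⟩ := hx'
  exact ⟨⟨z, hz⟩, rfl⟩

variable (G) in
theorem Polynomial.exists_forall_stabilizer_of_map_eq_X_mul (p : Ideal A) [p.IsMaximal]
    (Q : Ideal B) [Q.IsMaximal] [Q.LiesOver p]
    {f : A[X]} (hf : f.Monic) (hs : (f.map (algebraMap A B)).Splits)
    (hsep : (f.map (algebraMap A (A ⧸ p))).Separable)
    {g : (A ⧸ p)[X]} (hg : Irreducible g) (hfg : f.map (algebraMap A (A ⧸ p)) = X * g) :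
    ∃ a : f.rootSet B, ∀ x y, x ≠ a → y ≠ a → ∃ σ : G, σ • a = a ∧ σ • x = y := by
  obtain ⟨a, ha⟩ := exists_rootSet_mk_eq p Q hf hs (x := 0)
    (by rw [hfg, map_mul, aeval_X, zero_mul])
  have hroot (x : f.rootSet B) (hx : x ≠ a) : aeval (Ideal.Quotient.mk Q x.1) g = 0 := by
    have h := aeval_mk_map_quotient p Q f x.1
    rw [aeval_eq_zero_of_mem_rootSet x.2, map_zero, hfg, map_mul, aeval_X] at h
    refine (mul_eq_zero.mp h).resolve_left fun h0 ↦ hx ?_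
    exact injOn_mk_rootSet p Q hsep (h0.trans ha.symm)
  refine ⟨a, fun x y hx hy ↦ ?_⟩
  obtain ⟨σ, hσ, h⟩ := exists_smul_eq_of_irreducible_mod G p Q hsep hg x y (hroot x hx) (hroot y hy)
  exact ⟨σ, h a ⟨0, by rw [ha, map_zero]⟩, hσ⟩

attribute [local instance] Ideal.Quotient.field in
variable (G) in
theorem Polynomial.exists_isSwap_of_map_eq_mul (p : Ideal A) [p.IsMaximal]
    (Q : Ideal B) [Q.IsMaximal] [Q.LiesOver p]
    {f : A[X]} (hf : f.Monic) (hs : (f.map (algebraMap A B)).Splits)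
    (hsep : (f.map (algebraMap A (A ⧸ p))).Separable)
    {q h : (A ⧸ p)[X]} (hq : Irreducible q) (hq2 : q.natDegree = 2) (hh : h.Splits)
    (hfg : f.map (algebraMap A (A ⧸ p)) = q * h) [DecidableEq (f.rootSet B)] :
    ∃ σ : G, (MulAction.toPermHom G (f.rootSet B) σ).IsSwap := by
  have hne : q * h ≠ 0 := hfg ▸ (hf.map _).ne_zero
  have hroot (z : f.rootSet B) : aeval (Ideal.Quotient.mk Q z.1) q = 0 ∨
      Ideal.Quotient.mk Q z.1 ∈ Set.range (algebraMap (A ⧸ p) (B ⧸ Q)) := by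
    have h1 := aeval_mk_map_quotient p Q f z.1
    rw [aeval_eq_zero_of_mem_rootSet z.2, map_zero, hfg, map_mul] at h1
    refine (mul_eq_zero.mp h1).imp_right fun h2 ↦ ?_
    exact hh.mem_range_of_isRoot (right_ne_zero_of_mul hne)
      (by rwa [IsRoot, eval_map_algebraMap])
  have hqs : (q.map (algebraMap (A ⧸ p) (B ⧸ Q))).Splits := by
    have h1 : ((f.map (algebraMap A B)).map (Ideal.Quotient.mk Q)).Splits := hs.map _
    have h2 : (f.map (algebraMap A B)).map (Ideal.Quotient.mk Q) =
        (q * h).map (algebraMap (A ⧸ p) (B ⧸ Q)) := by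
      rw [← hfg, Polynomial.map_map, Polynomial.map_map]
      rfl
    rw [h2] at h1
    exact h1.of_dvd (map_ne_zero hne) (map_dvd _ (dvd_mul_right q h))
  have hcard : (q.rootSet (B ⧸ Q)).ncard = 2 := by
    rw [← Nat.card_coe_set_eq, Nat.card_eq_fintype_card, card_rootSet_eq_natDegree _ hqs, hq2]
    exact Separable.of_dvd hsep (hfg ▸ dvd_mul_right q h)
  obtain ⟨u, v, huv, hset⟩ := Set.ncard_eq_two.mp hcard
  have hmem (w : B ⧸ Q) : aeval w q = 0 ↔ w = u ∨ w = v := by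
    have := mem_rootSet_of_ne hq.ne_zero (a := w)
    rw [← this, hset]
    rfl
  obtain ⟨x, rfl⟩ := exists_rootSet_mk_eq p Q hf hs (x := u)
    (by rw [hfg, map_mul, (hmem u).mpr (.inl rfl), zero_mul])
  obtain ⟨y, rfl⟩ := exists_rootSet_mk_eq p Q hf hs (x := v)
    (by rw [hfg, map_mul, (hmem v).mpr (.inr rfl), zero_mul])
  have hxy : x ≠ y := fun h ↦ huv (by rw [h])
  obtain ⟨σ, hσ, hfix⟩ := exists_smul_eq_of_irreducible_mod G p Q hsep hq x y
    ((hmem _).mpr (.inl rfl)) ((hmem _).mpr (.inr rfl))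
  have hz (z : f.rootSet B) (hzx : z ≠ x) (hzy : z ≠ y) : σ • z = z := by
    refine hfix z ((hroot z).resolve_left fun h0 ↦ ?_)
    rcases (hmem _).mp h0 with h0 | h0
    · exact hzx (injOn_mk_rootSet p Q hsep h0)
    · exact hzy (injOn_mk_rootSet p Q hsep h0)
  have hy : σ • y = x := by
    by_contra hne
    by_cases hyy : σ • y = y
    · exact hxy (smul_left_cancel σ (hσ.trans hyy.symm))
    · exact hyy (smul_left_cancel σ (hz _ hne hyy))
  refine ⟨σ, x, y, hxy, Equiv.ext fun z ↦ ?_⟩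
  rw [MulAction.toPermHom_apply, MulAction.toPerm_apply]
  rcases eq_or_ne z x with rfl | hzx
  · rw [hσ, Equiv.swap_apply_left]
  rcases eq_or_ne z y with rfl | hzy
  · rw [hy, Equiv.swap_apply_right]
  rw [hz z hzx hzy, Equiv.swap_apply_of_ne_of_ne hzx hzy]

end

section FiniteField

variable (k : Type*) [Field k] [Finite k] {n : ℕ}

theorem FiniteField.exists_separable_X_mul_irreducible (hn : 2 ≤ n) :
    ∃ g : k[X], Irreducible g ∧ (X * g).Monic ∧ (X * g).natDegree = n ∧ (X * g).Separable := by
  obtain ⟨g, hm, hg, hd, h0⟩ :=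
    FiniteField.exists_monic_irreducible_natDegree_eq k (n := n - 1) (by lia)
  refine ⟨g, hg, monic_X.mul hm, ?_, ?_⟩
  · rw [natDegree_X_mul hm.ne_zero, hd]
    lia
  · refine separable_X.mul (PerfectField.separable_of_irreducible hg) ?_
    rwa [irreducible_X.coprime_iff_not_dvd, X_dvd_iff, coeff_zero_eq_eval_zero]

theorem FiniteField.exists_separable_quadratic_mul_splits (c : ℕ) [CharP k c] (hc : n ≤ c)
    (hn : 2 ≤ n) :
    ∃ q h : k[X], Irreducible q ∧ q.natDegree = 2 ∧ h.Splits ∧ (q * h).Monic ∧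
      (q * h).natDegree = n ∧ (q * h).Separable := by
  obtain ⟨q, hm, hq, hd, -⟩ :=
    FiniteField.exists_monic_irreducible_natDegree_eq k two_ne_zero
  have hhm : (∏ i ∈ Finset.range (n - 2), (X - C (i : k))).Monic :=
    monic_prod_of_monic _ _ fun i _ ↦ monic_X_sub_C _
  refine ⟨q, ∏ i ∈ Finset.range (n - 2), (X - C (i : k)), hq, hd,
    .prod fun i _ ↦ .X_sub_C _, hm.mul hhm, ?_, ?_⟩
  · rw [hm.natDegree_mul hhm, hd, natDegree_prod_of_monic _ _ fun i _ ↦ monic_X_sub_C _]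
    simp_rw [natDegree_X_sub_C, Finset.sum_const, Finset.card_range, smul_eq_mul]
    lia
  · refine (PerfectField.separable_of_irreducible hq).mul ?_ ?_
    · refine separable_prod' (fun i hi j hj hij ↦ ?_) fun i _ ↦ separable_X_sub_C
      refine isCoprime_X_sub_C_of_isUnit_sub (IsUnit.mk0 _ (sub_ne_zero.mpr ?_))
      simp only [Finset.mem_range] at hi hj
      exact fun h ↦ hij (CharP.natCast_injOn_Iio k c (Set.mem_Iio.mpr (by lia))
        (Set.mem_Iio.mpr (by lia)) h)
    · refine IsCoprime.prod_right fun i _ ↦ IsCoprime.symm ?_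
      rw [(irreducible_X_sub_C _).coprime_iff_not_dvd, dvd_iff_isRoot]
      intro h
      have : q.natDegree = 1 :=
        natDegree_eq_of_degree_eq_some (degree_eq_one_of_irreducible_of_root hq h)
      lia

end FiniteField

theorem NumberField.exists_isMaximal_charP_quotient (K : Type*) [Field K] [NumberField K] {ℓ : ℕ}
    (hℓ : ℓ.Prime) : ∃ p : Ideal (𝓞 K), p.IsMaximal ∧ CharP (𝓞 K ⧸ p) ℓ := by
  have : (Ideal.span {(ℓ : ℤ)}).IsMaximal :=
    PrincipalIdealRing.isMaximal_of_irreducible (Nat.prime_iff_prime_int.mp hℓ).irreducible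
  obtain ⟨p, hp, _⟩ :=
    Ideal.exists_maximal_ideal_liesOver_of_isIntegral (S := 𝓞 K) (Ideal.span {(ℓ : ℤ)})
  refine ⟨p, hp, (CharP.charP_iff_prime_eq_zero hℓ).mpr ?_⟩
  have h : (ℓ : ℤ) ∈ p.under ℤ := by
    rw [← Ideal.over_def p (Ideal.span {(ℓ : ℤ)})]
    exact Ideal.mem_span_singleton_self _
  rw [Ideal.under_def, Ideal.mem_comap] at h
  rw [← map_natCast (Ideal.Quotient.mk p), Ideal.Quotient.eq_zero_iff_mem]
  simpa using h

attribute [local instance] Ideal.Quotient.field in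
theorem NumberField.exists_monic_quotient_conditions (K : Type*) [Field K] [NumberField K] {n : ℕ}
    (hn : 2 ≤ n) :
    ∃ (f : (𝓞 K)[X]) (p : Fin 3 → Ideal (𝓞 K)), f.Monic ∧ (∀ i, (p i).IsMaximal) ∧
      (∀ i, (f.map (algebraMap (𝓞 K) (𝓞 K ⧸ p i))).natDegree = n) ∧
      (∀ i, (f.map (algebraMap (𝓞 K) (𝓞 K ⧸ p i))).Separable) ∧
      Irreducible (f.map (algebraMap (𝓞 K) (𝓞 K ⧸ p 0))) ∧
      (∃ g : (𝓞 K ⧸ p 1)[X], Irreducible g ∧ f.map (algebraMap (𝓞 K) (𝓞 K ⧸ p 1)) = X * g) ∧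
      ∃ q h : (𝓞 K ⧸ p 2)[X], Irreducible q ∧ q.natDegree = 2 ∧ h.Splits ∧
        f.map (algebraMap (𝓞 K) (𝓞 K ⧸ p 2)) = q * h := by
  have hinf : {ℓ : ℕ | ℓ.Prime ∧ n ≤ ℓ}.Infinite :=
    Set.infinite_of_not_bddAbove fun ⟨b, hb⟩ ↦ by
      obtain ⟨ℓ, hle, hℓ⟩ := Nat.exists_infinite_primes (max n b + 1)
      have := hb ⟨hℓ, by lia⟩
      lia
  let e : Fin 3 ↪ {ℓ : ℕ | ℓ.Prime ∧ n ≤ ℓ} :=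
    Fin.valEmbedding.trans (hinf.natEmbedding _)
  choose p hp hchar using fun i ↦ NumberField.exists_isMaximal_charP_quotient K (e i).2.1
  have hcop : Pairwise (Function.onFun IsCoprime p) := fun i j hij ↦ by
    refine Ideal.isCoprime_of_isMaximal fun h ↦ hij (e.injective (Subtype.ext ?_))
    have h1 := hchar i
    rw [h] at h1
    exact CharP.eq _ h1 (hchar j)
  obtain ⟨g₀, hm₀, hg₀, hd₀, -⟩ :=
    FiniteField.exists_monic_irreducible_natDegree_eq (𝓞 K ⧸ p 0) (n := n) (by lia)
  obtain ⟨g₁, hg₁, hm₁, hd₁, hs₁⟩ :=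
    FiniteField.exists_separable_X_mul_irreducible (𝓞 K ⧸ p 1) hn
  obtain ⟨q, h, hq, hq2, hh, hm₂, hd₂, hs₂⟩ :=
    FiniteField.exists_separable_quadratic_mul_splits (𝓞 K ⧸ p 2) (e 2) (e 2).2.2 hn
  obtain ⟨f, hf, hmap⟩ := exists_monic_map_quotient_eq hcop n
    (Fin.cons g₀ (Fin.cons (X * g₁) (Fin.cons (q * h) finZeroElim)))
    (by rintro i; fin_cases i; exacts [hm₀, hm₁, hm₂])
    (by rintro i; fin_cases i; exacts [hd₀, hd₁, hd₂])
  have h₀ : f.map (algebraMap (𝓞 K) (𝓞 K ⧸ p 0)) = g₀ := hmap 0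
  have h₁ : f.map (algebraMap (𝓞 K) (𝓞 K ⧸ p 1)) = X * g₁ := hmap 1
  have h₂ : f.map (algebraMap (𝓞 K) (𝓞 K ⧸ p 2)) = q * h := hmap 2
  refine ⟨f, p, hf, hp, fun i ↦ ?_, fun i ↦ ?_, h₀ ▸ hg₀, ⟨g₁, hg₁, h₁⟩, q, h, hq, hq2, hh, h₂⟩
  · fin_cases i
    exacts [h₀ ▸ hd₀, h₁ ▸ hd₁, h₂ ▸ hd₂]
  · fin_cases i
    exacts [h₀ ▸ PerfectField.separable_of_irreducible hg₀, h₁ ▸ hs₁, h₂ ▸ hs₂]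

attribute [local instance] Ideal.Quotient.field in
theorem Polynomial.natCard_rootSet_eq_natDegree_map {A B : Type*} [CommRing A] [CommRing B]
    [Algebra A B] [IsDomain B] (p : Ideal A) [p.IsMaximal]
    (Q : Ideal B) [Q.IsMaximal] [Q.LiesOver p]
    {f : A[X]} (hf : f.Monic) (hs : (f.map (algebraMap A B)).Splits)
    (hsep : (f.map (algebraMap A (A ⧸ p))).Separable) :
    Nat.card (f.rootSet B) = (f.map (algebraMap A (A ⧸ p))).natDegree := by
  have hs' : ((f.map (algebraMap A (A ⧸ p))).map (algebraMap (A ⧸ p) (B ⧸ Q))).Splits := by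
    have h1 : ((f.map (algebraMap A B)).map (Ideal.Quotient.mk Q)).Splits := hs.map _
    rw [Polynomial.map_map] at h1 ⊢
    exact h1
  rw [← card_rootSet_eq_natDegree hsep hs', ← Nat.card_eq_fintype_card]
  have hmem (x : B ⧸ Q) : x ∈ (f.map (algebraMap A (A ⧸ p))).rootSet (B ⧸ Q) ↔
      aeval x (f.map (algebraMap A (A ⧸ p))) = 0 := mem_rootSet_of_ne (hf.map _).ne_zero
  refine Nat.card_eq_of_bijective (fun z ↦ ⟨Ideal.Quotient.mk Q z, (hmem _).mpr ?_⟩) ⟨?_, ?_⟩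
  · rw [aeval_mk_map_quotient, aeval_eq_zero_of_mem_rootSet z.2, map_zero]
  · exact fun z w h ↦ injOn_mk_rootSet p Q hsep (congrArg Subtype.val h)
  · rintro ⟨x, hx⟩
    obtain ⟨z, rfl⟩ := exists_rootSet_mk_eq p Q hf hs ((hmem x).mp hx)
    exact ⟨z, rfl⟩

section RingOfIntegers

variable {K L : Type*} [Field K] [NumberField K] [Field L] [NumberField L] [Algebra K L]

omit [NumberField K] in
theorem NumberField.RingOfIntegers.splits_map_of_monic {f : (𝓞 K)[X]} (hf : f.Monic)
    (hs : ((f.map (algebraMap (𝓞 K) K)).map (algebraMap K L)).Splits) :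
    (f.map (algebraMap (𝓞 K) (𝓞 L))).Splits := by
  rw [Polynomial.map_map, ← IsScalarTower.algebraMap_eq, IsScalarTower.algebraMap_eq _ (𝓞 L),
    ← Polynomial.map_map] at hs
  refine hs.of_splits_map_of_injective (FaithfulSMul.algebraMap_injective (𝓞 L) L) fun a ha ↦ ?_
  refine IsIntegrallyClosed.isIntegral_iff.mp ⟨f.map (algebraMap (𝓞 K) (𝓞 L)), hf.map _, ?_⟩
  rw [← eval_map]
  exact isRoot_of_mem_roots ha

theorem NumberField.toPermHom_rootSet_injective [IsGalois K L] {f : (𝓞 K)[X]} (hf : f.Monic)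
    [hL : IsSplittingField K L (f.map (algebraMap (𝓞 K) K))] :
    Function.Injective (MulAction.toPermHom Gal(L/K) (f.rootSet (𝓞 L))) := by
  rw [injective_iff_map_eq_one]
  intro σ hσ
  suffices h : (σ : L →ₐ[K] L) = AlgHom.id K L from AlgEquiv.ext fun x ↦ DFunLike.congr_fun h x
  refine AlgHom.ext_of_adjoin_eq_top hL.adjoin_rootSet' fun x hx ↦ ?_
  have hx0 : eval₂ (algebraMap (𝓞 K) L) x f = 0 := by
    have := aeval_eq_zero_of_mem_rootSet hx
    rwa [aeval_map_algebraMap] at this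
  have hxi : IsIntegral (𝓞 K) x := ⟨f, hf, hx0⟩
  let y : 𝓞 L := ⟨x, isIntegral_trans x hxi⟩
  have hy : y ∈ f.rootSet (𝓞 L) := by
    refine (mem_rootSet_of_ne hf.ne_zero).mpr
      (FaithfulSMul.algebraMap_injective (𝓞 L) L ?_)
    rw [← aeval_algebraMap_apply, map_zero]
    exact hx0
  have := congrArg (fun z : f.rootSet (𝓞 L) ↦ (z.1 : L)) (DFunLike.congr_fun hσ ⟨y, hy⟩)
  exact this

end RingOfIntegers

theorem NumberField.exists_polynomial_gal_mulEquiv_perm (K : Type*) [Field K] [NumberField K]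
    {n : ℕ} (hn : 2 ≤ n) :
    ∃ f : K[X], ∀ (L : Type _) [Field L] [NumberField L] [Algebra K L] [IsGalois K L]
      [IsSplittingField K L f], Nonempty (Gal(L/K) ≃* Equiv.Perm (Fin n)) := by
  classical
  obtain ⟨f, p, hf, hp, hd, hsep, hirr, ⟨g, hg, hfg⟩, q, h, hq, hq2, hh, hfq⟩ :=
    exists_monic_quotient_conditions K hn
  refine ⟨f.map (algebraMap (𝓞 K) K), fun L _ _ _ _ hL ↦ ?_⟩
  have hs := RingOfIntegers.splits_map_of_monic hf hL.splits'
  choose Q hQ hQp using fun i ↦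
    Ideal.exists_maximal_ideal_liesOver_of_isIntegral (S := 𝓞 L) (p i)
  have hcard : Nat.card (f.rootSet (𝓞 L)) = n :=
    (natCard_rootSet_eq_natDegree_map (p 0) (Q 0) hf hs (hsep 0)).trans (hd 0)
  have htop : (MulAction.toPermHom Gal(L/K) (f.rootSet (𝓞 L))).range = ⊤ := by
    obtain ⟨a, ha⟩ := exists_forall_stabilizer_of_map_eq_X_mul Gal(L/K) (p 1) (Q 1) hf hs
      (hsep 1) hg hfg
    obtain ⟨τ, hτ⟩ := exists_isSwap_of_map_eq_mul Gal(L/K) (p 2) (Q 2) hf hs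
      (hsep 2) hq hq2 hh hfq
    refine Subgroup.eq_top_of_isSwap_mem _ (fun x y ↦ ?_) a (fun x y hx hy ↦ ?_) _ ⟨τ, rfl⟩ hτ
    · obtain ⟨σ, hσ⟩ := exists_smul_eq_of_irreducible_map Gal(L/K) (p 0) (Q 0) (hsep 0) hirr x y
      exact ⟨_, ⟨σ, rfl⟩, hσ⟩
    · obtain ⟨σ, hσa, hσ⟩ := ha x y hx hy
      exact ⟨_, ⟨σ, rfl⟩, hσa, hσ⟩
  exact ⟨(MulEquiv.ofBijective _ ⟨toPermHom_rootSet_injective hf,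
    MonoidHom.range_eq_top.mp htop⟩).trans (Finite.equivFinOfCardEq hcard).permCongrHom⟩

/-- For every number field `K` and every natural number `n`, the symmetric group
`S_n` is realisable as a Galois group over `K`: there exists a finite Galois extension `E/K`
with `Gal(E/K)` isomorphic to `S_n`. -/
theorem stmt_1 (K : Type*) [Field K] [NumberField K] (n : ℕ) :
    ∃ E : IntermediateField K (AlgebraicClosure K),
      FiniteDimensional K ↥E ∧ IsGalois K ↥E ∧
        Nonempty ((↥E ≃ₐ[K] ↥E) ≃* Equiv.Perm (Fin n)) := by
  obtain hn | hn := lt_or_ge n 2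
  · have : Subsingleton (Fin n) := Fin.subsingleton_iff_le_one.mpr (by lia)
    refine ⟨⊥, inferInstance, inferInstance, ⟨?_⟩⟩
    have : Subsingleton ((⊥ : IntermediateField K (AlgebraicClosure K)) ≃ₐ[K]
        (⊥ : IntermediateField K (AlgebraicClosure K))) :=
      (IntermediateField.botEquiv K (AlgebraicClosure K)).autCongr.toEquiv.subsingleton
    exact { toFun _ := 1
            invFun _ := 1
            left_inv _ := Subsingleton.elim _ _
            right_inv _ := Subsingleton.elim _ _
            map_mul' _ _ := (one_mul 1).symm }
  · obtain ⟨f, hf⟩ := NumberField.exists_polynomial_gal_mulEquiv_perm K hn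
    have hsplit : IsSplittingField K
        (IntermediateField.adjoin K (f.rootSet (AlgebraicClosure K))) f :=
      IntermediateField.adjoin_rootSet_isSplittingField (IsAlgClosed.splits _)
    have hfin := IsSplittingField.finiteDimensional
      (IntermediateField.adjoin K (f.rootSet (AlgebraicClosure K))) f
    have hnormal : Normal K (IntermediateField.adjoin K (f.rootSet (AlgebraicClosure K))) :=
      .of_isSplittingField f
    have hgal : IsGalois K (IntermediateField.adjoin K (f.rootSet (AlgebraicClosure K))) := ⟨⟩
    have := NumberField.of_module_finite K
      (IntermediateField.adjoin K (f.rootSet (AlgebraicClosure K)))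
    exact ⟨_, hfin, hgal, hf _⟩
end

section
/- Let K be a field with algebraic closure K̄, let E/K be a finite extension inside K̄, let F/K be a finite Galois extension inside K̄, and let E' be an intermediate field with K ⊆ E' ⊆ E. Then E ∩ F = K if and only if both E ∩ E'F = E' and E' ∩ F = K, where E'F denotes the compositum of E' and F inside K̄. -/
/-- Let `K` be a field with algebraic closure `K̄`, `E/K` a finite extension
inside `K̄`, `F/K` a finite Galois extension inside `K̄`, and `E'` an intermediate field with
`K ⊆ E' ⊆ E`. Then `E ∩ F = K` iff both `E ∩ E'F = E'` and `E' ∩ F = K`. -/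
theorem stmt_5 (K : Type*) [Field K]
    (E F E' : IntermediateField K (AlgebraicClosure K))
    [FiniteDimensional K ↥E] [FiniteDimensional K ↥F] [IsGalois K ↥F]
    (hE' : E' ≤ E) :
    E ⊓ F = ⊥ ↔ (E ⊓ (E' ⊔ F) = E' ∧ E' ⊓ F = ⊥) := by
  refine ⟨fun h ↦ ⟨?_, le_bot_iff.mp ((inf_le_inf_right F hE').trans h.le)⟩, fun ⟨h₁, h₂⟩ ↦ ?_⟩
  · have hd : E.LinearDisjoint F :=
      (IntermediateField.LinearDisjoint.of_inf_eq_bot (by rwa [inf_comm])).symm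
    have hle : E' ≤ E ⊓ (E' ⊔ F) := le_inf hE' le_sup_left
    have hsup : E ⊓ (E' ⊔ F) ⊔ F = E' ⊔ F :=
      le_antisymm (sup_le inf_le_right le_sup_right) (sup_le_sup_right hle F)
    have hM := (hd.of_le_left (A' := E ⊓ (E' ⊔ F)) inf_le_left).finrank_sup
    rw [hsup, (hd.of_le_left hE').finrank_sup] at hM
    exact (IntermediateField.eq_of_le_of_finrank_eq hle
      (Nat.eq_of_mul_eq_mul_right Module.finrank_pos hM)).symm
  · rw [← le_bot_iff, ← h₂]
    exact le_inf ((inf_le_inf_left E le_sup_right).trans h₁.le) inf_le_right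
end
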